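/- arXiv:1310.4708 — 8 statements merged into one kernel-verified Lean document; each statement's English description precedes it below -/
import Mathlib

section
/- Let α be a nonzero real number, let U ⊆ ℝ × (0,∞) be open, and let u : ℝ × ℝ → ℝ be twice continuously differentiable on U and satisfy the equivariant Faddeev equation on U. Define Φ₁(t,r) = ∫_π^{u(t,r)} (1 + α²r⁻²sin²y)^{1/2} dy. Then on U, Φ₁ is twice continuously differentiable and satisfies ∂ₜₜΦ₁ − ∂ᵣᵣΦ₁ − r⁻¹∂ᵣΦ₁ = (α⁻² − r⁻²)·Φ₁ − α⁻²·∫_π^{u(t,r)} (1 + α²r⁻²sin²y)^{−3/2} dy. -/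
open MeasureTheory

/-- Partial derivative in the first (time) variable. -/
noncomputable def pdt (w : ℝ × ℝ → ℝ) : ℝ × ℝ → ℝ :=
  fun p => deriv (fun t => w (t, p.2)) p.1

/-- Partial derivative in the second (radial) variable. -/
noncomputable def pdr (w : ℝ × ℝ → ℝ) : ℝ × ℝ → ℝ :=
  fun p => deriv (fun r => w (p.1, r)) p.2

/-- Differentiation of a primitive `∫ y in a..z, g (k, y)` jointly in the parameter `k`
and in the endpoint `z`. -/
theorem hasFDerivAt_parametric_primitive {g : ℝ × ℝ → ℝ} (hg : ContDiff ℝ 1 g) (a : ℝ)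
    (q : ℝ × ℝ) :
    HasFDerivAt (fun q : ℝ × ℝ => ∫ y in a..q.2, g (q.1, y))
      ((∫ y in a..q.2, fderiv ℝ g (q.1, y) (1, 0)) • ContinuousLinearMap.fst ℝ ℝ ℝ
        + g q • ContinuousLinearMap.snd ℝ ℝ ℝ) q := by
  have hg' : Continuous fun q : ℝ × ℝ => fderiv ℝ g q (1, 0) :=
    (hg.continuous_fderiv one_ne_zero).clm_apply continuous_const
  have hg0 : Continuous g := hg.continuous
  have hpart : ∀ v : ℝ × ℝ, HasDerivAt (fun k => ∫ y in a..v.2, g (k, y))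
      (∫ y in a..v.2, fderiv ℝ g (v.1, y) (1, 0)) v.1 := by
    intro v
    obtain ⟨M, hM⟩ := ((isCompact_closedBall v.1 1).prod
      (isCompact_uIcc (a := a) (b := v.2))).exists_bound_of_continuousOn hg'.continuousOn
    refine (intervalIntegral.hasDerivAt_integral_of_dominated_loc_of_deriv_le
      (bound := fun _ => M) (F' := fun k y => fderiv ℝ g (k, y) (1, 0))
      (Metric.closedBall_mem_nhds v.1 one_pos) ?_ ?_ ?_ ?_ ?_ ?_).2
    · exact Filter.Eventually.of_forall fun k =>
        (by fun_prop : Continuous fun y => g (k, y)).aestronglyMeasurable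
    · exact (by fun_prop : Continuous fun y => g (v.1, y)).intervalIntegrable _ _
    · exact (hg'.comp (by fun_prop : Continuous fun y : ℝ => (v.1, y))).aestronglyMeasurable
    · exact Filter.Eventually.of_forall fun y hy k hk =>
        hM (k, y) ⟨hk, Set.uIoc_subset_uIcc hy⟩
    · exact intervalIntegrable_const
    · refine Filter.Eventually.of_forall fun y _ k _ => ?_
      exact ((hg.differentiable one_ne_zero) (k, y)).hasFDerivAt.comp_hasDerivAt k
        ((hasDerivAt_id k).prodMk (hasDerivAt_const k y))
  have key := hasStrictFDerivAt_uncurry_coprod (𝕜 := ℝ) (u := q)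
    (f := fun k z => ∫ y in a..z, g (k, y))
    (f₁ := fun k z => ContinuousLinearMap.toSpanSingleton ℝ
      (∫ y in a..z, fderiv ℝ g (k, y) (1, 0)))
    (f₂ := fun k z => ContinuousLinearMap.toSpanSingleton ℝ (g (k, z)))
    (Filter.Eventually.of_forall fun v => (hpart v).hasFDerivAt)
    (Filter.Eventually.of_forall fun v => by
      have hc : Continuous fun y => g (v.1, y) := by fun_prop
      exact (intervalIntegral.integral_hasDerivAt_right (hc.intervalIntegrable _ _)
        (hc.stronglyMeasurableAtFilter _ _) hc.continuousAt).hasFDerivAt)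
    (Continuous.continuousAt (by
      refine (ContinuousLinearMap.toSpanSingletonCLE (𝕜 := ℝ) (E := ℝ)).continuous.comp ?_
      exact intervalIntegral.continuous_parametric_primitive_of_continuous
        (f := fun k y => fderiv ℝ g (k, y) (1, 0)) hg'))
    (Continuous.continuousAt
      ((ContinuousLinearMap.toSpanSingletonCLE (𝕜 := ℝ) (E := ℝ)).continuous.comp hg0))
  refine key.hasFDerivAt.congr_fderiv ?_
  ext <;> simp [Function.HasUncurry.uncurry]

theorem contDiff_parametric_primitive (n : ℕ) (a : ℝ) {g : ℝ × ℝ → ℝ} (hg : ContDiff ℝ n g) :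
    ContDiff ℝ n fun q : ℝ × ℝ => ∫ y in a..q.2, g (q.1, y) := by
  induction n generalizing g with
  | zero =>
    exact contDiff_zero.2 (intervalIntegral.continuous_parametric_primitive_of_continuous
      (f := fun k y => g (k, y)) hg.continuous)
  | succ n ih =>
    refine contDiff_succ_iff_hasFDerivAt.2 ⟨_, ?_, fun q =>
      hasFDerivAt_parametric_primitive (hg.of_le (by simp)) a q⟩
    have hg' : ContDiff ℝ n fun q : ℝ × ℝ => fderiv ℝ g q (1, 0) :=
      (hg.fderiv_right (by simp)).clm_apply contDiff_const
    exact ((ih hg').smul contDiff_const).add ((hg.of_le (by simp)).smul contDiff_const)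

/-- The density `1 + α² sin²(z) / r²` at `q = (r, z)`. -/
noncomputable def density (α : ℝ) (q : ℝ × ℝ) : ℝ := 1 + α ^ 2 * Real.sin q.2 ^ 2 / q.1 ^ 2

/-- The primitive `∫_π^z (1 + α² sin²(y) / r²)^s dy` at `q = (r, z)`. -/
noncomputable def densityPrimitive (α s : ℝ) (q : ℝ × ℝ) : ℝ :=
  ∫ y in Real.pi..q.2, density α (q.1, y) ^ s

theorem density_pos (α : ℝ) (q : ℝ × ℝ) : 0 < density α q := by
  unfold density; positivity

theorem continuous_density_right (α r : ℝ) : Continuous fun y => density α (r, y) := by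
  simp only [density, div_eq_mul_inv]
  fun_prop

theorem intervalIntegrable_density_rpow (α r s a b : ℝ) :
    IntervalIntegrable (fun y => density α (r, y) ^ s) volume a b :=
  ((continuous_density_right α r).rpow_const fun y =>
    Or.inl (density_pos α (r, y)).ne').intervalIntegrable _ _

theorem contDiff_one_add_sq_mul_sin_sq_rpow (s : ℝ) (n : WithTop ℕ∞) :
    ContDiff ℝ n fun q : ℝ × ℝ => (1 + q.1 ^ 2 * Real.sin q.2 ^ 2) ^ s :=
  ContDiff.rpow_const_of_ne (by fun_prop) fun q => by positivity

theorem densityPrimitive_eq (α s : ℝ) (q : ℝ × ℝ) :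
    densityPrimitive α s q =
      ∫ y in Real.pi..q.2, (1 + (α / q.1) ^ 2 * Real.sin y ^ 2) ^ s := by
  unfold densityPrimitive density
  congr 1; ext y; congr 2; ring

theorem contDiffAt_densityPrimitive (α s : ℝ) {q : ℝ × ℝ} (hq : q.1 ≠ 0) :
    ContDiffAt ℝ 2 (densityPrimitive α s) q := by
  have h := contDiff_parametric_primitive 2 Real.pi (contDiff_one_add_sq_mul_sin_sq_rpow s (2 : ℕ))
  have := h.contDiffAt.comp q (f := fun q : ℝ × ℝ => (α / q.1, q.2))
    ((contDiffAt_const.div contDiffAt_fst hq).prodMk contDiffAt_snd)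
  exact this.congr_of_eventuallyEq (Filter.Eventually.of_forall (densityPrimitive_eq α s))

theorem hasDerivAt_density {α x ρ' f' : ℝ} {ρ f : ℝ → ℝ} (hρ : HasDerivAt ρ ρ' x)
    (hf : HasDerivAt f f' x) (h0 : ρ x ≠ 0) :
    HasDerivAt (fun x => density α (ρ x, f x))
      (-(2 / ρ x) * (density α (ρ x, f x) - 1) * ρ'
        + 2 * α ^ 2 * Real.sin (f x) * Real.cos (f x) / ρ x ^ 2 * f') x := by
  have := (((hf.sin.pow 2).const_mul (α ^ 2)).div (hρ.pow 2) (pow_ne_zero 2 h0)).const_add 1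
  refine this.congr_deriv ?_
  simp only [density, Pi.pow_apply]
  field_simp
  ring

theorem hasDerivAt_density_rpow {α x ρ' f' : ℝ} {ρ f : ℝ → ℝ} (s : ℝ) (hρ : HasDerivAt ρ ρ' x)
    (hf : HasDerivAt f f' x) (h0 : ρ x ≠ 0) :
    HasDerivAt (fun x => density α (ρ x, f x) ^ s)
      (-(2 * s / ρ x) * (density α (ρ x, f x) ^ s - density α (ρ x, f x) ^ (s - 1)) * ρ'
        + 2 * s * α ^ 2 * Real.sin (f x) * Real.cos (f x) / ρ x ^ 2
          * density α (ρ x, f x) ^ (s - 1) * f') x := by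
  have hp := density_pos α (ρ x, f x)
  refine ((hasDerivAt_density hρ hf h0).rpow_const (p := s) (Or.inl hp.ne')).congr_deriv ?_
  rw [show density α (ρ x, f x) ^ s = density α (ρ x, f x) ^ (s - 1) * density α (ρ x, f x) by
    rw [← Real.rpow_add_one hp.ne']; ring_nf]
  ring

theorem hasDerivAt_densityPrimitive {α x ρ' f' : ℝ} {ρ f : ℝ → ℝ} (s : ℝ)
    (hρ : HasDerivAt ρ ρ' x) (hf : HasDerivAt f f' x) (h0 : ρ x ≠ 0) :
    HasDerivAt (fun x => densityPrimitive α s (ρ x, f x))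
      (-(2 * s / ρ x) * (densityPrimitive α s (ρ x, f x)
          - densityPrimitive α (s - 1) (ρ x, f x)) * ρ'
        + density α (ρ x, f x) ^ s * f') x := by
  have hg := contDiff_one_add_sq_mul_sin_sq_rpow s 1
  have h := (hasFDerivAt_parametric_primitive hg Real.pi (α / ρ x, f x)).comp_hasDerivAt x
    (((hasDerivAt_const x α).div hρ h0).prodMk hf)
  have hfun : (fun x => densityPrimitive α s (ρ x, f x)) = (fun q : ℝ × ℝ =>
      ∫ y in Real.pi..q.2, (1 + q.1 ^ 2 * Real.sin y ^ 2) ^ s) ∘ fun x => (α / ρ x, f x) := by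
    ext x; exact densityPrimitive_eq α s _
  rw [hfun]
  refine h.congr_deriv ?_
  have hpartial : ∀ y, fderiv ℝ (fun q : ℝ × ℝ => (1 + q.1 ^ 2 * Real.sin q.2 ^ 2) ^ s)
      (α / ρ x, y) (1, 0) * (α / ρ x)
        = 2 * s * (density α (ρ x, y) ^ s - density α (ρ x, y) ^ (s - 1)) := by
    intro y
    have hp := density_pos α (ρ x, y)
    have hd : 1 + (α / ρ x) ^ 2 * Real.sin y ^ 2 = density α (ρ x, y) := by
      unfold density; ring
    have h1 := ((hg.differentiable one_ne_zero) (α / ρ x, y)).hasFDerivAt.comp_hasDerivAt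
      (α / ρ x) ((hasDerivAt_id (α / ρ x)).prodMk (hasDerivAt_const (α / ρ x) y))
    have h2 : HasDerivAt (fun k : ℝ => (1 + k ^ 2 * Real.sin y ^ 2) ^ s) _ (α / ρ x) :=
      (((hasDerivAt_pow 2 (α / ρ x)).mul_const (Real.sin y ^ 2)).const_add 1).rpow_const
        (p := s) (Or.inl (by rw [hd]; exact hp.ne'))
    rw [h1.unique h2, hd,
      show density α (ρ x, y) ^ s = density α (ρ x, y) ^ (s - 1) * density α (ρ x, y) by
        rw [← Real.rpow_add_one hp.ne']; ring_nf]
    nth_rewrite 3 [← hd]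
    push_cast
    ring
  have hint : (∫ y in Real.pi..f x,
      fderiv ℝ (fun q : ℝ × ℝ => (1 + q.1 ^ 2 * Real.sin q.2 ^ 2) ^ s) (α / ρ x, y) (1, 0))
        * (α / ρ x)
      = 2 * s * (densityPrimitive α s (ρ x, f x) - densityPrimitive α (s - 1) (ρ x, f x)) := by
    rw [← intervalIntegral.integral_mul_const]
    simp only [hpartial, densityPrimitive]
    rw [intervalIntegral.integral_const_mul, intervalIntegral.integral_sub]
    all_goals exact intervalIntegrable_density_rpow _ _ _ _ _
  have hd : 1 + (α / ρ x) ^ 2 * Real.sin (f x) ^ 2 = density α (ρ x, f x) := by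
    unfold density; ring
  simp only [add_apply, smul_apply,
    ContinuousLinearMap.coe_fst', ContinuousLinearMap.coe_snd', smul_eq_mul, hd]
  linear_combination (-ρ' / ρ x) * hint

/-- The antiderivative identity that removes the boundary term `A^{-1/2} sin cos`. -/
theorem density_rpow_mul_sin_mul_cos {α r : ℝ} (hα : α ≠ 0) (hr : r ≠ 0) (z : ℝ) :
    density α (r, z) ^ (-(1 : ℝ) / 2) * (Real.sin z * Real.cos z)
      = (1 + r ^ 2 / α ^ 2) * densityPrimitive α (-(3 : ℝ) / 2) (r, z)
        - r ^ 2 / α ^ 2 * densityPrimitive α (1 / 2) (r, z) := by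
  have hderiv : ∀ y ∈ Set.uIcc Real.pi z,
      HasDerivAt (fun y => density α (r, y) ^ (-(1 : ℝ) / 2) * (Real.sin y * Real.cos y))
        ((1 + r ^ 2 / α ^ 2) * density α (r, y) ^ (-(3 : ℝ) / 2)
          - r ^ 2 / α ^ 2 * density α (r, y) ^ ((1 : ℝ) / 2)) y := by
    intro y _
    have hp := density_pos α (r, y)
    refine ((hasDerivAt_density_rpow (-(1 : ℝ) / 2) (hasDerivAt_const y r) (hasDerivAt_id y)
      hr).mul ((Real.hasDerivAt_sin y).mul (Real.hasDerivAt_cos y))).congr_deriv ?_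
    simp only [id, Pi.mul_apply]
    have e1 : density α (r, y) ^ (-(1 : ℝ) / 2)
        = density α (r, y) ^ (-(3 : ℝ) / 2) * density α (r, y) := by
      rw [← Real.rpow_add_one hp.ne']; norm_num
    have e2 : density α (r, y) ^ ((1 : ℝ) / 2)
        = density α (r, y) ^ (-(3 : ℝ) / 2) * density α (r, y) ^ 2 := by
      rw [← Real.rpow_natCast, ← Real.rpow_add hp]; norm_num
    rw [show -(1 : ℝ) / 2 - 1 = -(3 : ℝ) / 2 by norm_num, e1, e2]
    have hc : Real.cos y ^ 2 = 1 - Real.sin y ^ 2 := Real.cos_sq' y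
    generalize density α (r, y) ^ (-(3 : ℝ) / 2) = w
    simp only [density]
    field_simp
    ring_nf
    simp only [hc]
    ring
  have hFTC := intervalIntegral.integral_eq_sub_of_hasDerivAt hderiv
    (((intervalIntegrable_density_rpow _ _ _ _ _).const_mul _).sub
      ((intervalIntegrable_density_rpow _ _ _ _ _).const_mul _))
  rw [intervalIntegral.integral_sub ((intervalIntegrable_density_rpow _ _ _ _ _).const_mul _)
    ((intervalIntegrable_density_rpow _ _ _ _ _).const_mul _),
    intervalIntegral.integral_const_mul, intervalIntegral.integral_const_mul] at hFTC
  simp only [Real.sin_pi, zero_mul, mul_zero, sub_zero] at hFTC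
  exact hFTC.symm

theorem hasDerivAt_pdt {w : ℝ × ℝ → ℝ} {p : ℝ × ℝ} (hw : DifferentiableAt ℝ w p) :
    HasDerivAt (fun t => w (t, p.2)) (pdt w p) p.1 :=
  (DifferentiableAt.comp p.1 (f := fun t : ℝ => (t, p.2)) hw
    (by fun_prop)).hasDerivAt

theorem hasDerivAt_pdr {w : ℝ × ℝ → ℝ} {p : ℝ × ℝ} (hw : DifferentiableAt ℝ w p) :
    HasDerivAt (fun r => w (p.1, r)) (pdr w p) p.2 :=
  (DifferentiableAt.comp p.2 (f := fun r : ℝ => (p.1, r)) hw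
    (by fun_prop)).hasDerivAt

theorem pdt_eq_fderiv {w : ℝ × ℝ → ℝ} {p : ℝ × ℝ} (hw : DifferentiableAt ℝ w p) :
    pdt w p = fderiv ℝ w p (1, 0) :=
  (hasDerivAt_pdt hw).unique (hw.hasFDerivAt.comp_hasDerivAt p.1
    ((hasDerivAt_id p.1).prodMk (hasDerivAt_const p.1 p.2)))

theorem pdr_eq_fderiv {w : ℝ × ℝ → ℝ} {p : ℝ × ℝ} (hw : DifferentiableAt ℝ w p) :
    pdr w p = fderiv ℝ w p (0, 1) :=
  (hasDerivAt_pdr hw).unique (hw.hasFDerivAt.comp_hasDerivAt p.2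
    ((hasDerivAt_const p.2 p.1).prodMk (hasDerivAt_id p.2)))

theorem differentiableAt_fderiv_apply {w : ℝ × ℝ → ℝ} {p : ℝ × ℝ} (hw : ContDiffAt ℝ 2 w p)
    (v : ℝ × ℝ) : DifferentiableAt ℝ (fun q => fderiv ℝ w q v) p :=
  ((hw.fderiv_right (m := 1) (by norm_num)).differentiableAt one_ne_zero).clm_apply
    (differentiableAt_const v)

theorem differentiableAt_pdt {w : ℝ × ℝ → ℝ} {p : ℝ × ℝ} (hw : ContDiffAt ℝ 2 w p) :
    DifferentiableAt ℝ (pdt w) p :=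
  (differentiableAt_fderiv_apply hw (1, 0)).congr_of_eventuallyEq <|
    (hw.eventually (by simp)).mono fun _ hq => pdt_eq_fderiv (hq.differentiableAt two_ne_zero)

theorem differentiableAt_pdr {w : ℝ × ℝ → ℝ} {p : ℝ × ℝ} (hw : ContDiffAt ℝ 2 w p) :
    DifferentiableAt ℝ (pdr w) p :=
  (differentiableAt_fderiv_apply hw (0, 1)).congr_of_eventuallyEq <|
    (hw.eventually (by simp)).mono fun _ hq => pdr_eq_fderiv (hq.differentiableAt two_ne_zero)

theorem pdt_eq_of_hasDerivAt {w v : ℝ × ℝ → ℝ} {p : ℝ × ℝ} {d : ℝ}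
    (hwv : w =ᶠ[nhds p] v) (hv : HasDerivAt (fun t => v (t, p.2)) d p.1) : pdt w p = d :=
  (hv.congr_of_eventuallyEq <|
    (by fun_prop : Continuous fun t : ℝ => (t, p.2)).continuousAt (x := p.1) |>.eventually hwv).deriv

theorem pdr_eq_of_hasDerivAt {w v : ℝ × ℝ → ℝ} {p : ℝ × ℝ} {d : ℝ}
    (hwv : w =ᶠ[nhds p] v) (hv : HasDerivAt (fun r => v (p.1, r)) d p.2) : pdr w p = d :=
  (hv.congr_of_eventuallyEq <|
    (by fun_prop : Continuous fun r : ℝ => (p.1, r)).continuousAt (x := p.2) |>.eventually hwv).deriv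

/-- If `u` is `C²` on an open `U ⊆ ℝ × (0,∞)` and solves the equivariant Faddeev
equation there, then `Φ₁(t,r) = ∫_π^{u(t,r)} (1 + α²r⁻²sin²y)^{1/2} dy` is `C²` on `U`
and satisfies `∂ₜₜΦ₁ − ∂ᵣᵣΦ₁ − r⁻¹∂ᵣΦ₁ = (α⁻² − r⁻²)Φ₁ − α⁻²∫_π^u (1+α²r⁻²sin²y)^{−3/2} dy`. -/
theorem stmt1 (α : ℝ) (hα : α ≠ 0) (U : Set (ℝ × ℝ)) (hU : IsOpen U)
    (hUsub : ∀ p ∈ U, 0 < p.2) (u : ℝ × ℝ → ℝ) (hu : ContDiffOn ℝ 2 u U)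
    (A₁ : ℝ × ℝ → ℝ) (hA₁ : ∀ p : ℝ × ℝ, A₁ p = 1 + α ^ 2 * Real.sin (u p) ^ 2 / p.2 ^ 2)
    (hFaddeev : ∀ p ∈ U,
      pdt (pdt u) p - pdr (pdr u) p - p.2⁻¹ * pdr u p
        = -2 * p.2⁻¹ * (1 - (A₁ p)⁻¹) * pdr u p
          - (p.2 ^ 2)⁻¹ * (A₁ p)⁻¹ * (α ^ 2 * ((pdt u p) ^ 2 - (pdr u p) ^ 2) + 1)
            * Real.sin (u p) * Real.cos (u p))
    (Φ₁ : ℝ × ℝ → ℝ)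
    (hΦ₁ : ∀ p : ℝ × ℝ,
      Φ₁ p = ∫ y in Real.pi..(u p), Real.sqrt (1 + α ^ 2 * Real.sin y ^ 2 / p.2 ^ 2)) :
    ContDiffOn ℝ 2 Φ₁ U ∧
    ∀ p ∈ U,
      pdt (pdt Φ₁) p - pdr (pdr Φ₁) p - p.2⁻¹ * pdr Φ₁ p
        = ((α ^ 2)⁻¹ - (p.2 ^ 2)⁻¹) * Φ₁ p
          - (α ^ 2)⁻¹ * ∫ y in Real.pi..(u p),
              (1 + α ^ 2 * Real.sin y ^ 2 / p.2 ^ 2) ^ (-(3 : ℝ) / 2) := by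
  have hΦ : ∀ p, Φ₁ p = densityPrimitive α (1 / 2) (p.2, u p) := fun p => by
    rw [hΦ₁]
    simp only [densityPrimitive, density, Real.sqrt_eq_rpow]
  have huAt : ∀ p ∈ U, ContDiffAt ℝ 2 u p := fun p hp => hu.contDiffAt (hU.mem_nhds hp)
  have hr : ∀ p ∈ U, p.2 ≠ 0 := fun p hp => (hUsub p hp).ne'
  have hut : ∀ p ∈ U, HasDerivAt (fun t => u (t, p.2)) (pdt u p) p.1 := fun p hp =>
    hasDerivAt_pdt ((huAt p hp).differentiableAt two_ne_zero)
  have hur : ∀ p ∈ U, HasDerivAt (fun r => u (p.1, r)) (pdr u p) p.2 := fun p hp =>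
    hasDerivAt_pdr ((huAt p hp).differentiableAt two_ne_zero)
  have hΦt : ∀ p ∈ U, pdt Φ₁ p = density α (p.2, u p) ^ ((1 : ℝ) / 2) * pdt u p := by
    intro p hp
    refine pdt_eq_of_hasDerivAt (Filter.Eventually.of_forall hΦ) ?_
    refine (hasDerivAt_densityPrimitive (1 / 2) (hasDerivAt_const p.1 p.2) (hut p hp)
      (hr p hp)).congr_deriv ?_
    simp
  have hΦr : ∀ p ∈ U, pdr Φ₁ p = density α (p.2, u p) ^ ((1 : ℝ) / 2) * pdr u p
      - p.2⁻¹ * (densityPrimitive α (1 / 2) (p.2, u p)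
        - densityPrimitive α (-(1 : ℝ) / 2) (p.2, u p)) := by
    intro p hp
    refine pdr_eq_of_hasDerivAt (Filter.Eventually.of_forall hΦ) ?_
    refine (hasDerivAt_densityPrimitive (1 / 2) (hasDerivAt_id p.2) (hur p hp)
      (hr p hp)).congr_deriv ?_
    rw [show (1 : ℝ) / 2 - 1 = -(1 : ℝ) / 2 by norm_num]
    simp only [id]
    ring
  refine ⟨fun p hp => ?_, fun p hp => ?_⟩
  · have := (contDiffAt_densityPrimitive α (1 / 2) (q := (p.2, u p)) (hr p hp)).comp p
      (contDiffAt_snd.prodMk (huAt p hp))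
    exact (this.congr_of_eventuallyEq (Filter.Eventually.of_forall hΦ)).contDiffWithinAt
  have hr0 := hr p hp
  have hpU := hU.mem_nhds hp
  have hΦtt := pdt_eq_of_hasDerivAt (Filter.mem_of_superset hpU hΦt)
    ((hasDerivAt_density_rpow (α := α) (1 / 2) (hasDerivAt_const p.1 p.2) (hut p hp) hr0).mul
      (hasDerivAt_pdt (differentiableAt_pdt (huAt p hp))))
  have hΦrr := pdr_eq_of_hasDerivAt (Filter.mem_of_superset hpU hΦr)
    (((hasDerivAt_density_rpow (α := α) (1 / 2) (hasDerivAt_id p.2) (hur p hp) hr0).mul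
      (hasDerivAt_pdr (differentiableAt_pdr (huAt p hp)))).sub
      ((hasDerivAt_inv hr0).mul
        ((hasDerivAt_densityPrimitive (α := α) (1 / 2) (hasDerivAt_id p.2) (hur p hp) hr0).sub
          (hasDerivAt_densityPrimitive (α := α) (-(1 : ℝ) / 2) (hasDerivAt_id p.2)
            (hur p hp) hr0))))
  have hE := hFaddeev p hp
  have hB := density_rpow_mul_sin_mul_cos hα hr0 (u p)
  have hI : (∫ y in Real.pi..(u p), (1 + α ^ 2 * Real.sin y ^ 2 / p.2 ^ 2) ^ (-(3 : ℝ) / 2))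
      = densityPrimitive α (-(3 : ℝ) / 2) (p.2, u p) := rfl
  have hA : A₁ p = density α (p.2, u p) := hA₁ p
  rw [hΦtt, hΦrr, hΦr p hp, hΦ p, hI]
  rw [hA] at hE
  have hpos := density_pos α (p.2, u p)
  have e1 : density α (p.2, u p) ^ (-(1 : ℝ) / 2)
      = (density α (p.2, u p))⁻¹ * density α (p.2, u p) ^ ((1 : ℝ) / 2) := by
    rw [← Real.rpow_neg_one, ← Real.rpow_add hpos]; norm_num
  rw [e1] at hB
  simp only [id, Prod.mk.eta, show (1 : ℝ) / 2 - 1 = -(1 : ℝ) / 2 by norm_num,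
    show -(1 : ℝ) / 2 - 1 = -(3 : ℝ) / 2 by norm_num, e1]
  have hB' : (p.2 ^ 2)⁻¹ * ((density α (p.2, u p))⁻¹ * density α (p.2, u p) ^ ((1 : ℝ) / 2)
      * (Real.sin (u p) * Real.cos (u p)))
      = ((p.2 ^ 2)⁻¹ + (α ^ 2)⁻¹) * densityPrimitive α (-(3 : ℝ) / 2) (p.2, u p)
        - (α ^ 2)⁻¹ * densityPrimitive α (1 / 2) (p.2, u p) := by
    rw [hB]; field_simp
  linear_combination density α (p.2, u p) ^ ((1 : ℝ) / 2) * hE - hB'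
end

section
/- Let α be a nonzero real number and z ∈ ℝ. Define g : (0,∞) → ℝ by g(ρ) = ∫_π^z (1 + α²ρ⁻²sin²y)^{1/2} dy. Then g is twice differentiable on (0,∞), and for every ρ > 0 one has g''(ρ) + ρ⁻¹·g'(ρ) = ρ⁻²·∫_π^z (1 + α²ρ⁻²sin²y)^{−3/2}·((1 + α²ρ⁻²sin²y)² − 1) dy. -/
open MeasureTheory

open Set

/-- Differentiation under the integral sign over a compact interval, for a parameter in an open
set and a jointly continuous partial derivative. -/
theorem hasDerivAt_intervalIntegral_of_continuousOn {F F' : ℝ → ℝ → ℝ} {U : Set ℝ}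
    (hU : IsOpen U) {a b x₀ : ℝ} (hx₀ : x₀ ∈ U) (hF : ∀ x ∈ U, Continuous (F x))
    (hF' : ContinuousOn (fun p : ℝ × ℝ => F' p.1 p.2) (U ×ˢ univ))
    (hderiv : ∀ x ∈ U, ∀ y, HasDerivAt (fun x => F x y) (F' x y) x) :
    IntervalIntegrable (F' x₀) volume a b ∧
      HasDerivAt (fun x => ∫ y in a..b, F x y) (∫ y in a..b, F' x₀ y) x₀ := by
  obtain ⟨K, hK, hxK, hKU⟩ := exists_compact_subset hU hx₀
  obtain ⟨C, hC⟩ := (hK.prod (isCompact_uIcc (a := a) (b := b))).exists_bound_of_continuousOn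
    (hF'.mono (prod_mono hKU (subset_univ _)))
  have hF'₀ : Continuous (F' x₀) :=
    hF'.comp_continuous (f := fun y => (x₀, y)) (by fun_prop) fun y => ⟨hx₀, mem_univ y⟩
  refine intervalIntegral.hasDerivAt_integral_of_dominated_loc_of_deriv_le
    (bound := fun _ => C) (mem_interior_iff_mem_nhds.mp hxK) ?_
    ((hF x₀ hx₀).intervalIntegrable _ _) hF'₀.aestronglyMeasurable ?_
    intervalIntegrable_const ?_
  · filter_upwards [hU.mem_nhds hx₀] with x hx
    exact (hF x hx).aestronglyMeasurable
  · exact .of_forall fun y hy x hx => hC (x, y) ⟨hx, uIoc_subset_uIcc hy⟩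
  · exact .of_forall fun y _ x hx => hderiv x (hKU hx) y

theorem hasDerivAt_sqrt_one_add_div_sq {c x : ℝ} (hc : 0 ≤ c) (hx : 0 < x) :
    HasDerivAt (fun x => √(1 + c / x ^ 2)) (-c / (x ^ 3 * √(1 + c / x ^ 2))) x := by
  have hw : 0 < 1 + c / x ^ 2 := by positivity
  have hs : 0 < √(1 + c / x ^ 2) := Real.sqrt_pos.2 hw
  have h := ((((hasDerivAt_const x c).div (hasDerivAt_pow 2 x) (by positivity)).const_add 1).sqrt
    hw.ne')
  refine h.congr_deriv ?_
  simp only [Pi.div_apply]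
  generalize √(1 + c / x ^ 2) = s at hs
  field_simp
  push_cast
  ring

theorem hasDerivAt_neg_div_pow_mul_sqrt {c x : ℝ} (hc : 0 ≤ c) (hx : 0 < x) :
    HasDerivAt (fun x => -c / (x ^ 3 * √(1 + c / x ^ 2)))
      (3 * c / (x ^ 4 * √(1 + c / x ^ 2)) - c ^ 2 / (x ^ 6 * √(1 + c / x ^ 2) ^ 3)) x := by
  have hs : 0 < √(1 + c / x ^ 2) := Real.sqrt_pos.2 (by positivity)
  have h := (hasDerivAt_const x (-c)).div
    ((hasDerivAt_pow 3 x).mul (hasDerivAt_sqrt_one_add_div_sq hc hx)) (mul_pos (pow_pos hx 3) hs).ne'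
  refine h.congr_deriv ?_
  simp only [Pi.mul_apply]
  generalize √(1 + c / x ^ 2) = s at hs
  field_simp
  push_cast
  ring

theorem laplacian_sqrt_one_add_div_sq {c x : ℝ} (hc : 0 ≤ c) (hx : 0 < x) :
    3 * c / (x ^ 4 * √(1 + c / x ^ 2)) - c ^ 2 / (x ^ 6 * √(1 + c / x ^ 2) ^ 3)
        + x⁻¹ * (-c / (x ^ 3 * √(1 + c / x ^ 2)))
      = (x ^ 2)⁻¹ * ((1 + c / x ^ 2) ^ (-(3 : ℝ) / 2) * ((1 + c / x ^ 2) ^ 2 - 1)) := by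
  have hw : 0 < 1 + c / x ^ 2 := by positivity
  have hs : 0 < √(1 + c / x ^ 2) := Real.sqrt_pos.2 hw
  have hpow : (1 + c / x ^ 2) ^ (-(3 : ℝ) / 2) = (√(1 + c / x ^ 2) ^ 3)⁻¹ := by
    rw [← Real.rpow_natCast √(1 + c / x ^ 2) 3, Real.sqrt_eq_rpow, ← Real.rpow_mul hw.le, ← Real.rpow_neg hw.le]
    norm_num
  have hsq : √(1 + c / x ^ 2) ^ 2 = 1 + c / x ^ 2 := Real.sq_sqrt hw.le
  rw [hpow]
  generalize √(1 + c / x ^ 2) = s at hs hsq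
  have hsx : s ^ 2 * x ^ 2 = x ^ 2 + c := by rw [hsq]; field_simp
  field_simp
  linear_combination 2 * c * hsx

/-- For `g(ρ) = ∫_π^z (1 + α²ρ⁻²sin²y)^{1/2} dy`, `g` is twice differentiable on `(0,∞)`
and `g'' + ρ⁻¹g' = ρ⁻²∫_π^z (1+α²ρ⁻²sin²y)^{−3/2}((1+α²ρ⁻²sin²y)² − 1) dy`. -/
theorem stmt3 (α : ℝ) (hα : α ≠ 0) (z : ℝ) (g : ℝ → ℝ)
    (hg : ∀ ρ : ℝ, g ρ = ∫ y in Real.pi..z, Real.sqrt (1 + α ^ 2 * Real.sin y ^ 2 / ρ ^ 2)) :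
    ∀ ρ ∈ Set.Ioi (0 : ℝ),
      DifferentiableAt ℝ g ρ ∧ DifferentiableAt ℝ (deriv g) ρ ∧
      deriv (deriv g) ρ + ρ⁻¹ * deriv g ρ
        = (ρ ^ 2)⁻¹ * ∫ y in Real.pi..z,
            (1 + α ^ 2 * Real.sin y ^ 2 / ρ ^ 2) ^ (-(3 : ℝ) / 2)
              * ((1 + α ^ 2 * Real.sin y ^ 2 / ρ ^ 2) ^ 2 - 1) := by
  set c : ℝ → ℝ := fun y => α ^ 2 * Real.sin y ^ 2
  have hc : ∀ y, 0 ≤ c y := fun y => by positivity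
  have hc_cont : Continuous c := by fun_prop
  set F₁ : ℝ → ℝ → ℝ := fun x y => -c y / (x ^ 3 * √(1 + c y / x ^ 2))
  set F₂ : ℝ → ℝ → ℝ := fun x y => 3 * c y / (x ^ 4 * √(1 + c y / x ^ 2))
    - c y ^ 2 / (x ^ 6 * √(1 + c y / x ^ 2) ^ 3)
  have hs : ∀ x ∈ Ioi (0 : ℝ), ∀ y, 0 < √(1 + c y / x ^ 2) := fun x hx y => by
    have := hc y
    have : 0 < x := hx
    exact Real.sqrt_pos.2 (by positivity)
  have hs_cont : ContinuousOn (fun p : ℝ × ℝ => √(1 + c p.2 / p.1 ^ 2)) (Ioi 0 ×ˢ univ) := by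
    refine (continuousOn_const.add (ContinuousOn.div (by fun_prop) (by fun_prop) ?_)).sqrt
    exact fun p hp => pow_ne_zero 2 (ne_of_gt hp.1)
  have hF₁_cont : ContinuousOn (fun p : ℝ × ℝ => F₁ p.1 p.2) (Ioi 0 ×ˢ univ) :=
    ContinuousOn.div (by fun_prop) (ContinuousOn.mul (by fun_prop) hs_cont)
      fun p hp => mul_ne_zero (pow_ne_zero 3 (ne_of_gt hp.1)) (hs p.1 hp.1 p.2).ne'
  have hF₂_cont : ContinuousOn (fun p : ℝ × ℝ => F₂ p.1 p.2) (Ioi 0 ×ˢ univ) := by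
    refine (ContinuousOn.div (by fun_prop) (ContinuousOn.mul (by fun_prop) hs_cont) ?_).sub
      (ContinuousOn.div (by fun_prop) (ContinuousOn.mul (by fun_prop) (hs_cont.pow 3)) ?_)
    · exact fun p hp => mul_ne_zero (pow_ne_zero 4 (ne_of_gt hp.1)) (hs p.1 hp.1 p.2).ne'
    · exact fun p hp => mul_ne_zero (pow_ne_zero 6 (ne_of_gt hp.1))
        (pow_ne_zero 3 (hs p.1 hp.1 p.2).ne')
  have hg₁ : ∀ x ∈ Ioi (0 : ℝ), IntervalIntegrable (F₁ x) volume Real.pi z ∧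
      HasDerivAt g (∫ y in Real.pi..z, F₁ x y) x := fun x hx => by
    rw [funext hg]
    exact hasDerivAt_intervalIntegral_of_continuousOn isOpen_Ioi hx (fun x _ => by fun_prop)
      hF₁_cont fun x hx y => hasDerivAt_sqrt_one_add_div_sq (hc y) hx
  intro ρ hρ
  obtain ⟨hF₂_int, hg₂⟩ := hasDerivAt_intervalIntegral_of_continuousOn (a := Real.pi) (b := z)
    isOpen_Ioi hρ (fun x hx => hF₁_cont.comp_continuous (f := fun y => (x, y)) (by fun_prop)
      fun y => ⟨hx, mem_univ y⟩)
    hF₂_cont fun x hx y => hasDerivAt_neg_div_pow_mul_sqrt (hc y) hx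
  obtain ⟨hF₁_int, hgρ⟩ := hg₁ ρ hρ
  have hg' : HasDerivAt (deriv g) (∫ y in Real.pi..z, F₂ ρ y) ρ := by
    refine hg₂.congr_of_eventuallyEq ?_
    filter_upwards [isOpen_Ioi.mem_nhds hρ] with x hx using (hg₁ x hx).2.deriv
  refine ⟨hgρ.differentiableAt, hg'.differentiableAt, ?_⟩
  rw [hg'.deriv, hgρ.deriv, ← intervalIntegral.integral_const_mul,
    ← intervalIntegral.integral_const_mul,
    ← intervalIntegral.integral_add hF₂_int (hF₁_int.const_mul _)]
  exact intervalIntegral.integral_congr fun y _ => laplacian_sqrt_one_add_div_sq (hc y) hρ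
end

section
/- Let α be a nonzero real number. Then for every r > 0 and every z ∈ ℝ, one has the identity −(1/2)·r⁻²·(1 + α²r⁻²sin²z)^{−1/2}·sin(2z) = −r⁻²·∫_π^z (1 + α²r⁻²sin²y)^{−3/2}·[1 − α⁻²r²·((1 + α²r⁻²sin²y)² − 1)] dy. -/
open MeasureTheory

theorem hasDerivAt_rpow_mul_sin_mul_cos {k : ℝ} (hk : 0 ≤ k) (y : ℝ) :
    HasDerivAt (fun y => (1 + k * Real.sin y ^ 2) ^ (-(1 : ℝ) / 2) * (Real.sin y * Real.cos y))
      ((1 + k * Real.sin y ^ 2) ^ (-(3 : ℝ) / 2)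
        * (1 - 2 * Real.sin y ^ 2 - k * Real.sin y ^ 4)) y := by
  have hA : 0 < 1 + k * Real.sin y ^ 2 := by positivity
  have hbase : HasDerivAt (fun y => 1 + k * Real.sin y ^ 2)
      (k * (2 * Real.sin y * Real.cos y)) y := by
    simpa using (((Real.hasDerivAt_sin y).pow 2).const_mul k).const_add 1
  refine ((hbase.rpow_const (p := -(1 : ℝ) / 2) (Or.inl hA.ne')).mul
    ((Real.hasDerivAt_sin y).mul (Real.hasDerivAt_cos y))).congr_deriv ?_
  have hexp : (1 + k * Real.sin y ^ 2) ^ (-(1 : ℝ) / 2)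
      = (1 + k * Real.sin y ^ 2) ^ (-(3 : ℝ) / 2) * (1 + k * Real.sin y ^ 2) := by
    rw [← Real.rpow_add_one hA.ne']
    norm_num
  simp only [Pi.mul_apply]
  rw [hexp, show -(1 : ℝ) / 2 - 1 = -(3 : ℝ) / 2 by norm_num]
  linear_combination (1 + k * Real.sin y ^ 2) ^ (-(3 : ℝ) / 2)
    * Real.sin_sq_add_cos_sq y

theorem continuous_rpow_mul_sin_pow {k : ℝ} (hk : 0 ≤ k) (p : ℝ) :
    Continuous fun y => (1 + k * Real.sin y ^ 2) ^ p
      * (1 - 2 * Real.sin y ^ 2 - k * Real.sin y ^ 4) := by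
  refine Continuous.mul (Continuous.rpow_const (by fun_prop) fun y => Or.inl ?_) (by fun_prop)
  positivity

/-- Fundamental-theorem-of-calculus identity:
`−(1/2)r⁻²(1+α²r⁻²sin²z)^{−1/2}sin(2z)
  = −r⁻²∫_π^z (1+α²r⁻²sin²y)^{−3/2}[1 − α⁻²r²((1+α²r⁻²sin²y)² − 1)] dy`. -/
theorem stmt4 (α : ℝ) (hα : α ≠ 0) (r : ℝ) (hr : 0 < r) (z : ℝ) :
    -(1 / 2) * (r ^ 2)⁻¹ * (1 + α ^ 2 * Real.sin z ^ 2 / r ^ 2) ^ (-(1 : ℝ) / 2)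
        * Real.sin (2 * z)
      = -(r ^ 2)⁻¹ * ∫ y in Real.pi..z,
          (1 + α ^ 2 * Real.sin y ^ 2 / r ^ 2) ^ (-(3 : ℝ) / 2)
            * (1 - (α ^ 2)⁻¹ * r ^ 2 * ((1 + α ^ 2 * Real.sin y ^ 2 / r ^ 2) ^ 2 - 1)) := by
  have hk : 0 ≤ α ^ 2 / r ^ 2 := by positivity
  have hbase : ∀ y, 1 + α ^ 2 * Real.sin y ^ 2 / r ^ 2
      = 1 + α ^ 2 / r ^ 2 * Real.sin y ^ 2 := fun y => by ring
  have hfactor : ∀ y, 1 - (α ^ 2)⁻¹ * r ^ 2 * ((1 + α ^ 2 / r ^ 2 * Real.sin y ^ 2) ^ 2 - 1)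
      = 1 - 2 * Real.sin y ^ 2 - α ^ 2 / r ^ 2 * Real.sin y ^ 4 := fun y => by
    field_simp
    ring
  simp only [hbase, hfactor]
  rw [intervalIntegral.integral_eq_sub_of_hasDerivAt
    (fun y _ => hasDerivAt_rpow_mul_sin_mul_cos hk y)
    ((continuous_rpow_mul_sin_pow hk _).intervalIntegrable _ _),
    Real.sin_pi, Real.sin_two_mul]
  ring
end

section
/- Let α be a nonzero real number, U ⊆ ℝ × (0,∞) open, Φ : ℝ × ℝ → ℝ three times continuously differentiable on U, v : ℝ × ℝ → ℝ continuously differentiable on U, and h : ℝ → ℝ any function of the radial variable only. Write A(t,r) = 1 + α²r⁻²sin²(r·v(t,r)). Assume that on U: (i) ∂ₜΦ = A^{1/2}·∂ₜv, and (ii) ∂ₜₜΦ − ∂ᵣᵣΦ − 3r⁻¹∂ᵣΦ = α⁻²·(Φ − ∫₀^{v(t,r)} (1 + α²r⁻²sin²(ry))^{−3/2} dy) + h(r). Then on U the function Ψ := ∂ₜΦ satisfies ∂ₜₜΨ − ∂ᵣᵣΨ − 3r⁻¹∂ᵣΨ = α⁻²·(1 − A⁻²)·Ψ. -/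
open MeasureTheory

theorem ContDiffOn.differentiableAt_of_isOpen {w : ℝ × ℝ → ℝ} {U : Set (ℝ × ℝ)} {n : WithTop ℕ∞}
    (hw : ContDiffOn ℝ n w U) (hU : IsOpen U) (hn : n ≠ 0) {p : ℝ × ℝ} (hp : p ∈ U) :
    DifferentiableAt ℝ w p :=
  (hw.contDiffAt (hU.mem_nhds hp)).differentiableAt hn

theorem ContDiffOn.pdt {w : ℝ × ℝ → ℝ} {U : Set (ℝ × ℝ)} {m n : WithTop ℕ∞}
    (hw : ContDiffOn ℝ n w U) (hU : IsOpen U) (hmn : m + 1 ≤ n) : ContDiffOn ℝ m (pdt w) U := by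
  have hn : n ≠ 0 := by rintro rfl; simp at hmn
  exact ((hw.fderiv_of_isOpen hU hmn).clm_apply contDiffOn_const).congr
    fun p hp => pdt_eq_fderiv (hw.differentiableAt_of_isOpen hU hn hp)

theorem ContDiffOn.pdr {w : ℝ × ℝ → ℝ} {U : Set (ℝ × ℝ)} {m n : WithTop ℕ∞}
    (hw : ContDiffOn ℝ n w U) (hU : IsOpen U) (hmn : m + 1 ≤ n) : ContDiffOn ℝ m (pdr w) U := by
  have hn : n ≠ 0 := by rintro rfl; simp at hmn
  exact ((hw.fderiv_of_isOpen hU hmn).clm_apply contDiffOn_const).congr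
    fun p hp => pdr_eq_fderiv (hw.differentiableAt_of_isOpen hU hn hp)

theorem Set.EqOn.pdr {f g : ℝ × ℝ → ℝ} {U : Set (ℝ × ℝ)} (hfg : Set.EqOn f g U) (hU : IsOpen U) :
    Set.EqOn (pdr f) (pdr g) U := by
  intro p hp
  have hc : Filter.Tendsto (fun r : ℝ => (p.1, r)) (nhds p.2) (nhds p) :=
    Continuous.tendsto (f := fun r : ℝ => (p.1, r)) (by fun_prop) p.2
  exact Filter.EventuallyEq.deriv_eq
    ((hc.eventually (hU.mem_nhds hp)).mono fun r hr => hfg hr)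

/-- Equality of mixed partial derivatives for `C²` functions. -/
theorem pdt_pdr_comm {w : ℝ × ℝ → ℝ} {U : Set (ℝ × ℝ)} (hw : ContDiffOn ℝ 2 w U)
    (hU : IsOpen U) : Set.EqOn (pdt (pdr w)) (pdr (pdt w)) U := by
  intro p hp
  have hUp := hU.mem_nhds hp
  have hd : DifferentiableAt ℝ (fderiv ℝ w) p :=
    ((hw.fderiv_of_isOpen hU (m := 1) (by norm_num)).contDiffAt hUp).differentiableAt (by simp)
  have hsymm : IsSymmSndFDerivAt ℝ w p := (hw.contDiffAt hUp).isSymmSndFDerivAt (by simp)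
  have key : ∀ a : ℝ × ℝ, fderiv ℝ (fun q => fderiv ℝ w q a) p
      = (fderiv ℝ (fderiv ℝ w) p).flip a := fun a => by
    simpa using (hd.hasFDerivAt.clm_apply (hasFDerivAt_const a p)).fderiv
  have hr : pdr w =ᶠ[nhds p] fun q => fderiv ℝ w q (0, 1) := Filter.mem_of_superset hUp
    fun q hq => pdr_eq_fderiv (hw.differentiableAt_of_isOpen hU (by simp) hq)
  have ht : pdt w =ᶠ[nhds p] fun q => fderiv ℝ w q (1, 0) := Filter.mem_of_superset hUp
    fun q hq => pdt_eq_fderiv (hw.differentiableAt_of_isOpen hU (by simp) hq)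
  rw [pdt_eq_fderiv ((hw.pdr hU (m := 1) (by norm_num)).differentiableAt_of_isOpen hU
      (by simp) hp),
    pdr_eq_fderiv ((hw.pdt hU (m := 1) (by norm_num)).differentiableAt_of_isOpen hU
      (by simp) hp), hr.fderiv_eq, ht.fderiv_eq, key, key]
  exact hsymm (1, 0) (0, 1)

/-- If `∂ₜΦ = A^{1/2}∂ₜv` and `Φ` solves the 4D radial wave equation
`□Φ = α⁻²(Φ − ∫₀^v (1+α²r⁻²sin²(ry))^{−3/2} dy) + h(r)`, then `Ψ = ∂ₜΦ` solves
`□Ψ = α⁻²(1 − A⁻²)Ψ`, where `□ = ∂ₜₜ − ∂ᵣᵣ − 3r⁻¹∂ᵣ`. -/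
theorem stmt7 (α : ℝ) (hα : α ≠ 0) (U : Set (ℝ × ℝ)) (hU : IsOpen U)
    (hUsub : ∀ p ∈ U, 0 < p.2)
    (Φ v : ℝ × ℝ → ℝ) (hΦ : ContDiffOn ℝ 3 Φ U) (hv : ContDiffOn ℝ 1 v U)
    (h : ℝ → ℝ)
    (A : ℝ × ℝ → ℝ)
    (hA : ∀ p : ℝ × ℝ, A p = 1 + α ^ 2 * Real.sin (p.2 * v p) ^ 2 / p.2 ^ 2)
    (hi : ∀ p ∈ U, pdt Φ p = Real.sqrt (A p) * pdt v p)
    (hii : ∀ p ∈ U,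
      pdt (pdt Φ) p - pdr (pdr Φ) p - 3 * p.2⁻¹ * pdr Φ p
        = (α ^ 2)⁻¹ * (Φ p - ∫ y in (0 : ℝ)..(v p),
            (1 + α ^ 2 * Real.sin (p.2 * y) ^ 2 / p.2 ^ 2) ^ (-(3 : ℝ) / 2)) + h p.2) :
    ∀ p ∈ U,
      pdt (pdt (pdt Φ)) p - pdr (pdr (pdt Φ)) p - 3 * p.2⁻¹ * pdr (pdt Φ) p
        = (α ^ 2)⁻¹ * (1 - ((A p) ^ 2)⁻¹) * pdt Φ p := by
  rintro ⟨t, r⟩ hp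
  have hd : ∀ {w : ℝ × ℝ → ℝ}, ContDiffOn ℝ 1 w U →
      HasDerivAt (fun s => w (s, r)) (pdt w (t, r)) t :=
    fun hw => hasDerivAt_pdt (hw.differentiableAt_of_isOpen hU (by simp) hp)
  have hΦ2 : ContDiffOn ℝ 2 Φ U := hΦ.of_le (by norm_num)
  have hΦr : ContDiffOn ℝ 2 (pdr Φ) U := hΦ.pdr hU (by norm_num)
  have hΦt : ContDiffOn ℝ 2 (pdt Φ) U := hΦ.pdt hU (by norm_num)
  set f : ℝ → ℝ := fun y => (1 + α ^ 2 * Real.sin (r * y) ^ 2 / r ^ 2) ^ (-(3 : ℝ) / 2) with hf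
  have hpos : ∀ y, 0 < 1 + α ^ 2 * Real.sin (r * y) ^ 2 / r ^ 2 := fun y => by positivity
  have hfc : Continuous f :=
    Continuous.rpow_const (by fun_prop) fun y => Or.inl (hpos y).ne'
  have hI : HasDerivAt (fun s => ∫ y in (0 : ℝ)..(v (s, r)), f y)
      (f (v (t, r)) * pdt v (t, r)) t :=
    HasDerivAt.comp (h₂ := fun z => ∫ y in (0 : ℝ)..z, f y) t
      (hfc.integral_hasStrictDerivAt 0 (v (t, r))).hasDerivAt (hd hv)
  have hL := ((hd (hΦt.pdt hU (m := 1) (by norm_num))).sub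
    (hd (hΦr.pdr hU (m := 1) (by norm_num)))).sub
    ((hd (hΦr.of_le (by norm_num))).const_mul (3 * r⁻¹))
  have hR := (((hd (hΦ.of_le (by norm_num))).sub hI).const_mul (α ^ 2)⁻¹).add_const (h r)
  have hc : Filter.Tendsto (fun s : ℝ => (s, r)) (nhds t) (nhds (t, r)) :=
    Continuous.tendsto (f := fun s : ℝ => (s, r)) (by fun_prop) t
  have hderiv := hR.unique (hL.congr_of_eventuallyEq
    ((hc.eventually (hU.mem_nhds hp)).mono fun s hs => (hii (s, r) hs).symm))
  rw [pdt_pdr_comm hΦr hU hp, (pdt_pdr_comm hΦ2 hU).pdr hU hp, pdt_pdr_comm hΦ2 hU hp] at hderiv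
  have hApos : 0 < A (t, r) := by rw [hA]; exact hpos _
  have hfA : f (v (t, r)) = (A (t, r) * √(A (t, r)))⁻¹ := by
    simp only [hf, hA]
    rw [neg_div, Real.rpow_neg (hpos _).le, Real.sqrt_eq_rpow,
      ← Real.rpow_one_add' (hpos _).le (by norm_num)]
    norm_num
  rw [← hderiv, hfA, hi _ hp]
  have hs := Real.sqrt_pos.2 hApos
  have hs2 := Real.sq_sqrt hApos.le
  set a := √(A (t, r))
  rw [← hs2]
  field_simp
end

section
/- Define F̃₁ : ℝ → ℝ by F̃₁(x) = x⁻²·(1 − x⁻¹·sin x·cos x) for x ≠ 0 and F̃₁(0) = 2/3. Then: F̃₁ is real-analytic on all of ℝ; F̃₁ is even; for every k ∈ ℕ there is a constant C_k such that |F̃₁^{(k)}(x)| ≤ C_k for all x ∈ ℝ; and for every k ∈ ℕ, F̃₁^{(k)}(x) → 0 as |x| → ∞. -/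
/-- Functions polynomial in `x⁻¹`, `sin x` and `cos x`. -/
noncomputable def invTrigAlgebra : Subalgebra ℝ (ℝ → ℝ) :=
  Algebra.adjoin ℝ {fun x => x⁻¹, Real.sin, Real.cos}

lemma inv_mem_invTrigAlgebra : (fun x : ℝ => x⁻¹) ∈ invTrigAlgebra :=
  Algebra.subset_adjoin (by simp)

lemma sin_mem_invTrigAlgebra : Real.sin ∈ invTrigAlgebra :=
  Algebra.subset_adjoin (by simp)

lemma cos_mem_invTrigAlgebra : Real.cos ∈ invTrigAlgebra :=
  Algebra.subset_adjoin (by simp)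

lemma exists_bound_of_mem_invTrigAlgebra {f : ℝ → ℝ} (hf : f ∈ invTrigAlgebra) :
    ∃ C : ℝ, ∀ x : ℝ, 1 ≤ |x| → |f x| ≤ C := by
  induction hf using Algebra.adjoin_induction with
  | mem f hf =>
    refine ⟨1, fun x hx => ?_⟩
    rcases hf with rfl | rfl | rfl
    · simpa [abs_inv] using inv_le_one_of_one_le₀ hx
    · exact Real.abs_sin_le_one x
    · exact Real.abs_cos_le_one x
  | algebraMap r => exact ⟨|r|, fun x _ => by simp⟩
  | add f g _ _ hf hg =>
    obtain ⟨A, hA⟩ := hf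
    obtain ⟨B, hB⟩ := hg
    exact ⟨A + B, fun x hx => (abs_add_le _ _).trans (add_le_add (hA x hx) (hB x hx))⟩
  | mul f g _ _ hf hg =>
    obtain ⟨A, hA⟩ := hf
    obtain ⟨B, hB⟩ := hg
    refine ⟨A * B, fun x hx => ?_⟩
    rw [Pi.mul_apply, abs_mul]
    exact mul_le_mul (hA x hx) (hB x hx) (abs_nonneg _) ((abs_nonneg _).trans (hA x hx))

lemma exists_hasDerivAt_of_mem_invTrigAlgebra {f : ℝ → ℝ} (hf : f ∈ invTrigAlgebra) :
    ∃ g ∈ invTrigAlgebra, ∀ x : ℝ, x ≠ 0 → HasDerivAt f (g x) x := by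
  induction hf using Algebra.adjoin_induction with
  | mem f hf =>
    rcases hf with rfl | rfl | rfl
    · refine ⟨_, neg_mem (mul_mem inv_mem_invTrigAlgebra inv_mem_invTrigAlgebra),
        fun x hx => ?_⟩
      have h : (-((fun y : ℝ => y⁻¹) * fun y : ℝ => y⁻¹)) x = -(x ^ 2)⁻¹ := by
        simp [sq]
      exact h ▸ hasDerivAt_inv hx
    · exact ⟨_, cos_mem_invTrigAlgebra, fun x _ => Real.hasDerivAt_sin x⟩
    · exact ⟨_, neg_mem sin_mem_invTrigAlgebra, fun x _ => Real.hasDerivAt_cos x⟩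
  | algebraMap r => exact ⟨0, zero_mem _, fun x _ => hasDerivAt_const x r⟩
  | add f g _ _ hf hg =>
    obtain ⟨f', hf', hdf⟩ := hf
    obtain ⟨g', hg', hdg⟩ := hg
    exact ⟨f' + g', add_mem hf' hg', fun x hx => (hdf x hx).add (hdg x hx)⟩
  | mul f g hf₀ hg₀ hf hg =>
    obtain ⟨f', hf', hdf⟩ := hf
    obtain ⟨g', hg', hdg⟩ := hg
    exact ⟨f' * g + f * g', add_mem (mul_mem hf' hg₀) (mul_mem hf₀ hg'),
      fun x hx => (hdf x hx).mul (hdg x hx)⟩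

lemma exists_iteratedDeriv_eq_inv_mul {f : ℝ → ℝ} {b : ℝ → ℝ} (hb : b ∈ invTrigAlgebra)
    (hf : ∀ x : ℝ, x ≠ 0 → f x = x⁻¹ * b x) (k : ℕ) :
    ∃ c ∈ invTrigAlgebra, ∀ x : ℝ, x ≠ 0 → iteratedDeriv k f x = x⁻¹ * c x := by
  induction k with
  | zero => exact ⟨b, hb, by simpa using hf⟩
  | succ k ih =>
    obtain ⟨c, hc, h⟩ := ih
    obtain ⟨c', hc', hd⟩ := exists_hasDerivAt_of_mem_invTrigAlgebra hc
    refine ⟨_, sub_mem hc' (mul_mem inv_mem_invTrigAlgebra hc), fun x hx => ?_⟩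
    have heq : iteratedDeriv k f =ᶠ[nhds x] fun y => y⁻¹ * c y := by
      filter_upwards [isOpen_ne.mem_nhds hx] with y hy using h y hy
    rw [iteratedDeriv_succ, heq.deriv_eq, ((hasDerivAt_inv hx).fun_mul (hd x hx)).deriv]
    simp only [Pi.sub_apply, Pi.mul_apply]
    field_simp
    ring

lemma tendsto_zero_of_eq_inv_mul {f b : ℝ → ℝ} (hb : b ∈ invTrigAlgebra)
    (hf : ∀ x : ℝ, x ≠ 0 → f x = x⁻¹ * b x) :
    Filter.Tendsto f (Filter.cocompact ℝ) (nhds 0) := by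
  obtain ⟨C, hC⟩ := exists_bound_of_mem_invTrigAlgebra hb
  have hlim : Filter.Tendsto (fun x : ℝ => |x|⁻¹ * C) (Filter.cocompact ℝ) (nhds 0) := by
    simpa using (tendsto_inv_atTop_zero.comp (tendsto_norm_cocompact_atTop (E := ℝ))).mul_const C
  refine squeeze_zero_norm' ?_ hlim
  filter_upwards [(tendsto_norm_cocompact_atTop (E := ℝ)).eventually_ge_atTop 1] with x hx
  rw [Real.norm_eq_abs] at hx ⊢
  rw [hf x (abs_pos.mp (by linarith)), abs_mul, abs_inv]
  exact mul_le_mul_of_nonneg_left (hC x hx) (by positivity)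

lemma exists_abs_le_of_continuous_of_tendsto_zero {f : ℝ → ℝ} (hc : Continuous f)
    (hf : Filter.Tendsto f (Filter.cocompact ℝ) (nhds 0)) : ∃ C : ℝ, ∀ x : ℝ, |f x| ≤ C := by
  let g : ZeroAtInftyContinuousMap ℝ ℝ := ⟨⟨f, hc⟩, hf⟩
  exact ⟨‖g.toBCF‖, fun x => g.toBCF.norm_coe_le_norm x⟩

lemma abs_inv_sq_mul_one_sub_sub_le {x : ℝ} (hx : x ≠ 0) (hx' : |x| ≤ 1 / 2) :
    |(x ^ 2)⁻¹ * (1 - x⁻¹ * Real.sin x * Real.cos x) - 2 / 3| ≤ |x| := by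
  have h := Real.sin_bound (x := 2 * x) (by rw [abs_mul, abs_two]; linarith)
  have heq : (x ^ 2)⁻¹ * (1 - x⁻¹ * Real.sin x * Real.cos x) - 2 / 3 =
      -(Real.sin (2 * x) - (2 * x - (2 * x) ^ 3 / 6)) / (2 * x ^ 3) := by
    rw [Real.sin_two_mul]
    field_simp
    ring
  have hpos : 0 < |x| := abs_pos.mpr hx
  rw [heq, abs_div, abs_neg, abs_mul, abs_pow, abs_two, div_le_iff₀ (by positivity)]
  refine h.trans ?_
  rw [abs_mul, abs_two]
  nlinarith [pow_pos hpos 4]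

/-- Properties of `F̃₁(x) = x⁻²(1 − x⁻¹ sin x cos x)` (with `F̃₁(0) = 2/3`): it is
real-analytic on `ℝ`, even, and all of its iterated derivatives are bounded and
tend to `0` at infinity. -/
theorem stmt10 (F : ℝ → ℝ)
    (hF : ∀ x : ℝ,
      F x = if x = 0 then 2 / 3 else (x ^ 2)⁻¹ * (1 - x⁻¹ * Real.sin x * Real.cos x)) :
    AnalyticOnNhd ℝ F Set.univ ∧
    (∀ x : ℝ, F (-x) = F x) ∧
    (∀ k : ℕ, ∃ C : ℝ, ∀ x : ℝ, |iteratedDeriv k F x| ≤ C) ∧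
    (∀ k : ℕ, Filter.Tendsto (iteratedDeriv k F) (Filter.cocompact ℝ) (nhds 0)) := by
  have hF0 : ∀ x : ℝ, x ≠ 0 → F x = (x ^ 2)⁻¹ * (1 - x⁻¹ * Real.sin x * Real.cos x) :=
    fun x hx => by rw [hF, if_neg hx]
  have hcont : ContinuousAt F 0 := by
    rw [ContinuousAt, tendsto_iff_norm_sub_tendsto_zero]
    refine squeeze_zero' (.of_forall fun _ => norm_nonneg _) ?_
      (continuous_abs.tendsto' (0 : ℝ) 0 abs_zero)
    filter_upwards [Metric.closedBall_mem_nhds (0 : ℝ) one_half_pos] with x hx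
    rcases eq_or_ne x 0 with rfl | hx0
    · simp
    · rw [hF0 x hx0, hF 0, if_pos rfl]
      exact abs_inv_sq_mul_one_sub_sub_le hx0 (by simpa using hx)
  have hana : AnalyticOnNhd ℝ F Set.univ := by
    intro x _
    rcases eq_or_ne x 0 with rfl | hx
    · refine MeromorphicAt.analyticAt ?_ hcont
      have hmer : MeromorphicAt
          (fun x : ℝ => (x ^ 2)⁻¹ * (1 - x⁻¹ * Real.sin x * Real.cos x)) 0 := by
        have hs := (Real.analyticAt_sin (x := 0)).meromorphicAt
        have hc := (Real.analyticAt_cos (x := 0)).meromorphicAt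
        fun_prop
      refine hmer.congr ?_
      filter_upwards [self_mem_nhdsWithin] with x hx using (hF0 x hx).symm
    · have han : AnalyticAt ℝ
          (fun x : ℝ => (x ^ 2)⁻¹ * (1 - x⁻¹ * Real.sin x * Real.cos x)) x := by
        have hs := Real.analyticAt_sin (x := x)
        have hc := Real.analyticAt_cos (x := x)
        have hx2 : x ^ 2 ≠ 0 := pow_ne_zero 2 hx
        fun_prop (disch := assumption)
      refine han.congr ?_
      filter_upwards [isOpen_ne.mem_nhds hx] with y hy using (hF0 y hy).symm
  have htendsto (k : ℕ) :
      Filter.Tendsto (iteratedDeriv k F) (Filter.cocompact ℝ) (nhds 0) := by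
    have hinv := inv_mem_invTrigAlgebra
    obtain ⟨c, hc, h⟩ := exists_iteratedDeriv_eq_inv_mul (f := F)
      (mul_mem hinv (sub_mem (one_mem _)
        (mul_mem (mul_mem hinv sin_mem_invTrigAlgebra) cos_mem_invTrigAlgebra)))
      (fun x hx => by
        simp only [hF0 x hx, Pi.mul_apply, Pi.sub_apply, Pi.one_apply]
        ring) k
    exact tendsto_zero_of_eq_inv_mul hc h
  have hsmooth : ContDiff ℝ ⊤ F := contDiff_iff_contDiffAt.mpr fun x =>
    (hana x trivial).contDiffAt
  refine ⟨hana, fun x => ?_, fun k => ?_, htendsto⟩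
  · simp [hF, inv_neg]
  · exact exists_abs_le_of_continuous_of_tendsto_zero
      (hsmooth.continuous_iteratedDeriv k le_top) (htendsto k)
end

section
/- (Strauss radial lemma, weighted one-dimensional form.) Let n ≥ 2 be a natural number and let g : (0,∞) → ℝ be continuously differentiable with ∫₀^∞ g(s)²·s^{n−1} ds < ∞ and ∫₀^∞ g'(s)²·s^{n−1} ds < ∞. Then for every r > 0, g(r)²·r^{n−1} ≤ 2·(∫₀^∞ g(s)²·s^{n−1} ds)^{1/2}·(∫₀^∞ g'(s)²·s^{n−1} ds)^{1/2}. -/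
open MeasureTheory

/-- If `u` is differentiable on `(0, ∞)` and `u² s^m`, `(u')² s^m` are integrable there, then
`u(r)² r^m` is bounded by the Young-type combination of the two integrals, for each `t > 0`. -/
theorem sq_mul_pow_le_mul_integral_add_integral_div (m : ℕ) {u : ℝ → ℝ}
    (hu : ∀ s, 0 < s → HasDerivAt u (deriv u s) s)
    (hint : IntegrableOn (fun s => u s ^ 2 * s ^ m) (Set.Ioi 0))
    (hint' : IntegrableOn (fun s => (deriv u s) ^ 2 * s ^ m) (Set.Ioi 0))
    {r t : ℝ} (hr : 0 < r) (ht : 0 < t) :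
    u r ^ 2 * r ^ m ≤ t * (∫ s in Set.Ioi (0 : ℝ), u s ^ 2 * s ^ m)
      + (∫ s in Set.Ioi (0 : ℝ), (deriv u s) ^ 2 * s ^ m) / t := by
  set φ : ℝ → ℝ := fun s => t * (u s ^ 2 * s ^ m) + (deriv u s) ^ 2 * s ^ m / t with hφ
  have hφint : IntegrableOn φ (Set.Ioi 0) := (hint.const_mul t).add (hint'.div_const t)
  have hφ_eq : ∫ s in Set.Ioi (0 : ℝ), φ s = t * (∫ s in Set.Ioi (0 : ℝ), u s ^ 2 * s ^ m)
      + (∫ s in Set.Ioi (0 : ℝ), (deriv u s) ^ 2 * s ^ m) / t := by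
    rw [hφ, integral_add (hint.const_mul t) (hint'.div_const t), integral_const_mul,
      integral_div]
  rw [← hφ_eq]
  have key : ∀ R, r < R → u r ^ 2 * r ^ m ≤ u R ^ 2 * R ^ m + ∫ s in Set.Ioi (0 : ℝ), φ s := by
    intro R hR
    have hsub : Set.Icc r R ⊆ Set.Ioi 0 := fun s hs => hr.trans_le hs.1
    have hder : ∀ s, 0 < s →
        HasDerivAt (fun s => -(u s ^ 2 * r ^ m)) (-(2 * u s * deriv u s * r ^ m)) s := by
      intro s hs
      exact (((hu s hs).pow 2).mul_const (r ^ m)).neg.congr_deriv (by simp)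
    have h1 := intervalIntegral.sub_le_integral_of_hasDeriv_right_of_le hR.le
      (g := fun s => -(u s ^ 2 * r ^ m)) (φ := φ)
      (fun s hs => (hder s (hsub hs)).continuousAt.continuousWithinAt)
      (fun s hs => (hder s (hr.trans hs.1)).hasDerivWithinAt)
      (hφint.mono_set hsub) (by
        intro s hs
        have hw : r ^ m ≤ s ^ m := pow_le_pow_left₀ hr.le hs.1.le m
        have hwr : 0 ≤ r ^ m := by positivity
        have hyoung : -(2 * u s * deriv u s) ≤ t * u s ^ 2 + deriv u s ^ 2 / t := by
          have : t * u s ^ 2 + deriv u s ^ 2 / t + 2 * u s * deriv u s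
              = (t * u s + deriv u s) ^ 2 / t := by field_simp; ring
          have : 0 ≤ (t * u s + deriv u s) ^ 2 / t := by positivity
          linarith
        have hnn : 0 ≤ t * u s ^ 2 + deriv u s ^ 2 / t := by positivity
        calc -(2 * u s * deriv u s * r ^ m) = -(2 * u s * deriv u s) * r ^ m := by ring
          _ ≤ (t * u s ^ 2 + deriv u s ^ 2 / t) * r ^ m := by gcongr
          _ ≤ (t * u s ^ 2 + deriv u s ^ 2 / t) * s ^ m := by gcongr
          _ = φ s := by rw [hφ]; ring)
    have h2 : ∫ s in r..R, φ s ≤ ∫ s in Set.Ioi (0 : ℝ), φ s := by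
      rw [intervalIntegral.integral_of_le hR.le]
      refine setIntegral_mono_set hφint ?_
        (Set.Ioc_subset_Icc_self.trans hsub).eventuallyLE
      filter_upwards [ae_restrict_mem measurableSet_Ioi] with s hs
      have : (0 : ℝ) < s := hs
      simp only [hφ, Pi.zero_apply]
      positivity
    have h3 : u R ^ 2 * r ^ m ≤ u R ^ 2 * R ^ m := by gcongr
    linarith
  by_contra! hlt
  set d := u r ^ 2 * r ^ m - ∫ s in Set.Ioi (0 : ℝ), φ s with hd
  have hdpos : 0 < d := sub_pos.2 hlt
  have hconst : IntegrableOn (fun _ : ℝ => d) (Set.Ioi r) := by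
    refine (hint.mono_set (Set.Ioi_subset_Ioi hr.le)).mono' aestronglyMeasurable_const ?_
    filter_upwards [ae_restrict_mem measurableSet_Ioi] with s hs
    rw [Real.norm_of_nonneg hdpos.le]
    linarith [key s hs]
  rw [integrableOn_const_iff] at hconst
  simp [hdpos.ne'] at hconst

/-- Strauss radial lemma (weighted one-dimensional form): if `g` is `C¹` on `(0,∞)` with
`∫₀^∞ g²s^{n−1} ds < ∞` and `∫₀^∞ (g')²s^{n−1} ds < ∞`, then for every `r > 0`,
`g(r)²r^{n−1} ≤ 2(∫₀^∞ g²s^{n−1})^{1/2}(∫₀^∞ (g')²s^{n−1})^{1/2}`. -/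
theorem stmt12 (n : ℕ) (hn : 2 ≤ n) (g : ℝ → ℝ)
    (hg : ContDiffOn ℝ 1 g (Set.Ioi 0))
    (hint : IntegrableOn (fun s => g s ^ 2 * s ^ (n - 1)) (Set.Ioi 0))
    (hint' : IntegrableOn (fun s => (deriv g s) ^ 2 * s ^ (n - 1)) (Set.Ioi 0)) :
    ∀ r : ℝ, 0 < r →
      g r ^ 2 * r ^ (n - 1)
        ≤ 2 * Real.sqrt (∫ s in Set.Ioi (0 : ℝ), g s ^ 2 * s ^ (n - 1))
            * Real.sqrt (∫ s in Set.Ioi (0 : ℝ), (deriv g s) ^ 2 * s ^ (n - 1)) := by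
  intro r hr
  have hderiv : ∀ s, 0 < s → HasDerivAt g (deriv g s) s := fun s hs =>
    ((hg.differentiableOn one_ne_zero).differentiableAt (Ioi_mem_nhds hs)).hasDerivAt
  have key := fun t (ht : 0 < t) =>
    sq_mul_pow_le_mul_integral_add_integral_div (n - 1) hderiv hint hint' hr ht
  have hA : 0 ≤ ∫ s in Set.Ioi (0 : ℝ), g s ^ 2 * s ^ (n - 1) :=
    setIntegral_nonneg measurableSet_Ioi fun s (hs : 0 < s) => by positivity
  have hB : 0 ≤ ∫ s in Set.Ioi (0 : ℝ), (deriv g s) ^ 2 * s ^ (n - 1) :=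
    setIntegral_nonneg measurableSet_Ioi fun s (hs : 0 < s) => by positivity
  have hX : 0 ≤ g r ^ 2 * r ^ (n - 1) := by positivity
  generalize (∫ s in Set.Ioi (0 : ℝ), g s ^ 2 * s ^ (n - 1)) = A at *
  generalize (∫ s in Set.Ioi (0 : ℝ), (deriv g s) ^ 2 * s ^ (n - 1)) = B at *
  generalize g r ^ 2 * r ^ (n - 1) = X at *
  have hquad : ∀ t : ℝ, 0 ≤ A * (t * t) + (-X) * t + B := by
    intro t
    rcases le_or_gt t 0 with ht | ht
    · nlinarith [mul_nonneg hA (mul_self_nonneg t), mul_nonneg hX (neg_nonneg.2 ht)]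
    · have h := mul_le_mul_of_nonneg_right (key t ht) ht.le
      rw [add_mul, div_mul_cancel₀ _ ht.ne'] at h
      linarith
  have hdisc := discrim_le_zero hquad
  rw [discrim] at hdisc
  refine (sq_le_sq₀ hX (by positivity)).1 ?_
  rw [mul_pow, mul_pow, Real.sq_sqrt hA, Real.sq_sqrt hB]
  linarith
end

section
/- (Sobolev embedding via the Fourier transform.) Let n ≥ 1 and k ≥ 0 be natural numbers and let s be a real number with s > n/2 + k. There exists a constant C > 0 (depending only on n, s, k) such that for every Schwartz function f : ℝⁿ → ℂ and every multi-index β with |β| ≤ k, sup_{x ∈ ℝⁿ} |∂^β f(x)| ≤ C·( ∫_{ℝⁿ} (1 + ‖ξ‖²)^s·|𝓕f(ξ)|² dξ )^{1/2}. -/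
open MeasureTheory
open scoped FourierTransform

/-- Directional derivative of a function along a vector. -/
noncomputable def dirDeriv {n : ℕ} (e : EuclideanSpace ℝ (Fin n))
    (f : EuclideanSpace ℝ (Fin n) → ℂ) : EuclideanSpace ℝ (Fin n) → ℂ :=
  fun x => fderiv ℝ f x e

/-- The multi-index partial derivative `∂^β f = ∂₁^{β 1} ⋯ ∂ₙ^{β n} f`. -/
noncomputable def pderivMulti {n : ℕ} (β : Fin n → ℕ)
    (f : EuclideanSpace ℝ (Fin n) → ℂ) : EuclideanSpace ℝ (Fin n) → ℂ :=
  (List.finRange n).foldr (fun i g => (dirDeriv (EuclideanSpace.single i 1))^[β i] g) f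

open scoped LineDeriv SchwartzMap in
theorem SchwartzMap.norm_fourier_lineDerivOp_le {V : Type*} [NormedAddCommGroup V]
    [InnerProductSpace ℝ V] [FiniteDimensional ℝ V] [MeasurableSpace V] [BorelSpace V]
    (f : 𝓢(V, ℂ)) (m ξ : V) :
    ‖𝓕 (∂_{m} f) ξ‖ ≤ 2 * Real.pi * ‖ξ‖ * ‖m‖ * ‖𝓕 f ξ‖ := by
  have hg : (fun x : V => inner ℝ x m).HasTemperateGrowth := by fun_prop
  rw [SchwartzMap.fourier_lineDerivOp_eq, smul_apply,
    SchwartzMap.smulLeftCLM_apply_apply hg, norm_smul, norm_smul]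
  have h1 : ‖(2 * Real.pi * Complex.I : ℂ)‖ = 2 * Real.pi := by
    simp [abs_of_pos Real.pi_pos]
  have h2 : ‖inner ℝ ξ m‖ ≤ ‖ξ‖ * ‖m‖ := norm_inner_le_norm ξ m
  rw [h1]
  calc 2 * Real.pi * (‖inner ℝ ξ m‖ * ‖𝓕 f ξ‖)
      ≤ 2 * Real.pi * ((‖ξ‖ * ‖m‖) * ‖𝓕 f ξ‖) := by gcongr
    _ = _ := by ring

open scoped SchwartzMap in
theorem SchwartzMap.norm_apply_le_integral_norm_fourier {V : Type*} [NormedAddCommGroup V]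
    [InnerProductSpace ℝ V] [FiniteDimensional ℝ V] [MeasurableSpace V] [BorelSpace V]
    (f : 𝓢(V, ℂ)) (x : V) : ‖f x‖ ≤ ∫ ξ, ‖𝓕 f ξ‖ := by
  have h : f x = 𝓕⁻ (⇑(𝓕 f : 𝓢(V, ℂ))) x := by
    rw [← SchwartzMap.fourierInv_coe, FourierTransform.fourierInv_fourier_eq]
  rw [h, Real.fourierInv_eq']
  refine (norm_integral_le_integral_norm _).trans (le_of_eq ?_)
  congr 1 with ξ
  rw [norm_smul, Complex.norm_exp]
  simp

open scoped LineDeriv SchwartzMap in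
theorem exists_schwartzMap_iterate_dirDeriv {n : ℕ} (e : EuclideanSpace ℝ (Fin n))
    (he : ‖e‖ = 1) (f : 𝓢(EuclideanSpace ℝ (Fin n), ℂ)) (m : ℕ) :
    ∃ h : 𝓢(EuclideanSpace ℝ (Fin n), ℂ), ⇑h = (dirDeriv e)^[m] f ∧
      ∀ ξ, ‖𝓕 h ξ‖ ≤ (2 * Real.pi * ‖ξ‖) ^ m * ‖𝓕 f ξ‖ := by
  induction m with
  | zero => exact ⟨f, rfl, by simp⟩
  | succ m ih =>
    obtain ⟨h, hh, hb⟩ := ih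
    refine ⟨∂_{e} h, ?_, fun ξ => ?_⟩
    · rw [Function.iterate_succ_apply', ← hh]
      rfl
    · calc ‖𝓕 (∂_{e} h) ξ‖ ≤ 2 * Real.pi * ‖ξ‖ * ‖e‖ * ‖𝓕 h ξ‖ :=
            h.norm_fourier_lineDerivOp_le e ξ
        _ ≤ 2 * Real.pi * ‖ξ‖ * ‖e‖ * ((2 * Real.pi * ‖ξ‖) ^ m * ‖𝓕 f ξ‖) := by
            gcongr
            exact hb ξ
        _ = _ := by rw [he]; ring

open scoped SchwartzMap in
theorem exists_schwartzMap_pderivMulti {n : ℕ} (β : Fin n → ℕ)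
    (f : 𝓢(EuclideanSpace ℝ (Fin n), ℂ)) :
    ∃ h : 𝓢(EuclideanSpace ℝ (Fin n), ℂ), ⇑h = pderivMulti β f ∧
      ∀ ξ, ‖𝓕 h ξ‖ ≤ (2 * Real.pi * ‖ξ‖) ^ (∑ i, β i) * ‖𝓕 f ξ‖ := by
  suffices H : ∀ l : List (Fin n), ∃ h : 𝓢(EuclideanSpace ℝ (Fin n), ℂ),
      ⇑h = l.foldr (fun i g => (dirDeriv (EuclideanSpace.single i 1))^[β i] g) ⇑f ∧
      ∀ ξ, ‖𝓕 h ξ‖ ≤ (2 * Real.pi * ‖ξ‖) ^ (l.map β).sum * ‖𝓕 f ξ‖ by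
    simpa only [pderivMulti, Fin.sum_univ_def] using H (List.finRange n)
  intro l
  induction l with
  | nil => exact ⟨f, rfl, by simp⟩
  | cons i l ih =>
    obtain ⟨h, hh, hb⟩ := ih
    obtain ⟨h', hh', hb'⟩ := exists_schwartzMap_iterate_dirDeriv
      (EuclideanSpace.single i (1 : ℝ)) (by simp) h (β i)
    refine ⟨h', by rw [hh', hh, List.foldr_cons], fun ξ => (hb' ξ).trans ?_⟩
    rw [List.map_cons, List.sum_cons, pow_add, mul_assoc (_ ^ β i)]
    exact mul_le_mul_of_nonneg_left (hb ξ) (by positivity)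

open scoped SchwartzMap in
theorem SchwartzMap.norm_smulLeftCLM_one_add_norm_sq_rpow {V : Type*} [NormedAddCommGroup V]
    [InnerProductSpace ℝ V] (g : 𝓢(V, ℂ)) (r : ℝ) :
    (fun ξ => ‖SchwartzMap.smulLeftCLM ℂ (fun ξ : V => (1 + ‖ξ‖ ^ 2) ^ r) g ξ‖) =
      fun ξ => (1 + ‖ξ‖ ^ 2) ^ r * ‖g ξ‖ := by
  have hg := Function.hasTemperateGrowth_one_add_norm_sq_rpow V r
  ext ξ
  rw [SchwartzMap.smulLeftCLM_apply_apply hg, norm_smul, Real.norm_of_nonneg (by positivity)]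

open scoped SchwartzMap in
/-- Weighted Cauchy–Schwarz inequality on the Fourier side. -/
theorem SchwartzMap.integral_weight_mul_norm_le {V : Type*} [NormedAddCommGroup V]
    [InnerProductSpace ℝ V] [FiniteDimensional ℝ V] [MeasurableSpace V] [BorelSpace V]
    (g : 𝓢(V, ℂ)) {r s : ℝ} (hrs : (Module.finrank ℝ V : ℝ) / 2 + r < s) :
    ∫ ξ, (1 + ‖ξ‖ ^ 2) ^ (r / 2) * ‖g ξ‖ ≤
      √(∫ ξ : V, (1 + ‖ξ‖ ^ 2) ^ (r - s)) * √(∫ ξ, (1 + ‖ξ‖ ^ 2) ^ s * ‖g ξ‖ ^ 2) := by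
  have hsq (t : ℝ) (ξ : V) : ((1 + ‖ξ‖ ^ 2) ^ (t / 2)) ^ 2 = (1 + ‖ξ‖ ^ 2) ^ t := by
    rw [← Real.rpow_mul_natCast (by positivity)]
    simp
  have hcont (t : ℝ) : Continuous fun ξ : V => (1 + ‖ξ‖ ^ 2) ^ t :=
    (Function.hasTemperateGrowth_one_add_norm_sq_rpow V t).1.continuous
  have hu : MemLp (fun ξ : V => (1 + ‖ξ‖ ^ 2) ^ ((r - s) / 2)) (ENNReal.ofReal 2) := by
    rw [ENNReal.ofReal_ofNat, memLp_two_iff_integrable_sq (hcont _).aestronglyMeasurable]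
    simp_rw [hsq]
    rw [show r - s = -(2 * (s - r)) / 2 by ring]
    exact integrable_rpow_neg_one_add_norm_sq (by linarith)
  have hv : MemLp (fun ξ : V => (1 + ‖ξ‖ ^ 2) ^ (s / 2) * ‖g ξ‖) (ENNReal.ofReal 2) := by
    rw [← g.norm_smulLeftCLM_one_add_norm_sq_rpow]
    exact (SchwartzMap.memLp _ _ _).norm
  have key := integral_mul_le_Lp_mul_Lq_of_nonneg Real.HolderConjugate.two_two
    (Filter.Eventually.of_forall fun ξ => by positivity)
    (Filter.Eventually.of_forall fun ξ => by positivity) hu hv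
  simp_rw [Real.rpow_two, mul_pow, hsq, ← Real.sqrt_eq_rpow] at key
  refine le_of_eq_of_le (integral_congr_ae (.of_forall fun ξ => ?_)) key
  simp only
  rw [← mul_assoc, ← Real.rpow_add (by positivity)]
  ring_nf

/-- Sobolev embedding `H^s(ℝⁿ) ↪ L^∞ ∩ C^k` for `s > n/2 + k`, via the Fourier
transform: `sup |∂^β f| ≤ C‖f‖_{H^s}` for all multi-indices `|β| ≤ k`. -/
theorem stmt16 (n k : ℕ) (hn : 1 ≤ n) (s : ℝ) (hs : (n : ℝ) / 2 + (k : ℝ) < s) :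
    ∃ C : ℝ, 0 < C ∧ ∀ f : SchwartzMap (EuclideanSpace ℝ (Fin n)) ℂ,
      ∀ β : Fin n → ℕ, (∑ i, β i) ≤ k →
      ∀ x : EuclideanSpace ℝ (Fin n),
        ‖pderivMulti β (⇑f) x‖
          ≤ C * Real.sqrt (∫ ξ : EuclideanSpace ℝ (Fin n),
              (1 + ‖ξ‖ ^ 2) ^ s * ‖𝓕 (⇑f) ξ‖ ^ 2) := by
  refine ⟨(2 * Real.pi) ^ k * √(∫ ξ : EuclideanSpace ℝ (Fin n), (1 + ‖ξ‖ ^ 2) ^ (k - s)) + 1,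
    by positivity, fun f β hβ x => ?_⟩
  obtain ⟨h, hh, hb⟩ := exists_schwartzMap_pderivMulti β f
  have hpi : 1 ≤ 2 * Real.pi := by linarith [Real.pi_gt_three]
  have hpt (ξ : EuclideanSpace ℝ (Fin n)) :
      ‖𝓕 h ξ‖ ≤ (2 * Real.pi) ^ k * ((1 + ‖ξ‖ ^ 2) ^ ((k : ℝ) / 2) * ‖𝓕 f ξ‖) := by
    have hw : (1 + ‖ξ‖ ^ 2) ^ ((k : ℝ) / 2) = √(1 + ‖ξ‖ ^ 2) ^ k := by
      rw [Real.sqrt_eq_rpow, ← Real.rpow_mul_natCast (by positivity)]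
      ring_nf
    have h1 : 1 ≤ √(1 + ‖ξ‖ ^ 2) := Real.one_le_sqrt.2 (by simp)
    have h2 : ‖ξ‖ ≤ √(1 + ‖ξ‖ ^ 2) := Real.le_sqrt_of_sq_le (by simp)
    calc ‖𝓕 h ξ‖ ≤ (2 * Real.pi * ‖ξ‖) ^ (∑ i, β i) * ‖𝓕 f ξ‖ := hb ξ
      _ ≤ (2 * Real.pi * √(1 + ‖ξ‖ ^ 2)) ^ (∑ i, β i) * ‖𝓕 f ξ‖ := by gcongr
      _ ≤ (2 * Real.pi * √(1 + ‖ξ‖ ^ 2)) ^ k * ‖𝓕 f ξ‖ := by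
          gcongr
          exact one_le_mul_of_one_le_of_one_le hpi h1
      _ = _ := by rw [hw]; ring
  have hint : Integrable fun ξ : EuclideanSpace ℝ (Fin n) =>
      (1 + ‖ξ‖ ^ 2) ^ ((k : ℝ) / 2) * ‖𝓕 f ξ‖ := by
    rw [← SchwartzMap.norm_smulLeftCLM_one_add_norm_sq_rpow]
    exact (SchwartzMap.integrable _).norm
  rw [← hh, ← SchwartzMap.fourier_coe]
  calc ‖h x‖ ≤ ∫ ξ, ‖𝓕 h ξ‖ := h.norm_apply_le_integral_norm_fourier x
    _ ≤ ∫ ξ, (2 * Real.pi) ^ k * ((1 + ‖ξ‖ ^ 2) ^ ((k : ℝ) / 2) * ‖𝓕 f ξ‖) :=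
        integral_mono (𝓕 h).integrable.norm (hint.const_mul _) hpt
    _ ≤ (2 * Real.pi) ^ k * (√(∫ ξ : EuclideanSpace ℝ (Fin n), (1 + ‖ξ‖ ^ 2) ^ (k - s)) *
          √(∫ ξ, (1 + ‖ξ‖ ^ 2) ^ s * ‖𝓕 f ξ‖ ^ 2)) := by
        rw [integral_const_mul]
        gcongr
        exact (𝓕 f).integral_weight_mul_norm_le (by simpa using hs)
    _ ≤ _ := by
        rw [← mul_assoc]
        gcongr
        linarith
end

section
/- (Radial Sobolev embedding via the Fourier transform.) Let n ≥ 2 be a natural number and let s be a real number with 1/2 < s < n/2. There exists a constant C > 0 (depending only on n and s) such that for every Schwartz function f : ℝⁿ → ℂ that is radial (i.e. f(x) = f(y) whenever ‖x‖ = ‖y‖) and every x ∈ ℝⁿ with x ≠ 0, |f(x)| ≤ C·‖x‖^{s − n/2}·( ∫_{ℝⁿ} ‖ξ‖^{2s}·|𝓕f(ξ)|² dξ )^{1/2}. -/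
open MeasureTheory
open scoped FourierTransform

section

open Real Set
open scoped ENNReal RealInnerProductSpace

variable {E : Type*} [NormedAddCommGroup E] [InnerProductSpace ℝ E] [FiniteDimensional ℝ E]
  [MeasurableSpace E] [BorelSpace E]

lemma integrable_exp_neg_mul_norm_sq {b : ℝ} (hb : 0 < b) :
    Integrable fun ξ : E ↦ rexp (-b * ‖ξ‖ ^ 2) :=
  .of_integral_ne_zero (by rw [GaussianFourier.integral_rexp_neg_mul_sq_norm hb]; positivity)

lemma norm_charFun_sq_eq_integral (μ : Measure E) [IsFiniteMeasure μ] (ξ : E) :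
    ((‖charFun μ ξ‖ ^ 2 : ℝ) : ℂ)
      = ∫ p : E × E, Complex.exp (Complex.I * ⟪p.1 - p.2, ξ⟫) ∂(μ.prod μ) := by
  rw [← Complex.normSq_eq_norm_sq, ← Complex.mul_conj, ← charFun_neg, charFun_apply, charFun_apply,
    ← integral_prod_mul]
  congr 1 with p
  rw [← Complex.exp_add, inner_sub_left, inner_neg_right]
  push_cast
  ring_nf

lemma integral_gaussian_mul_norm_charFun_sq (μ : Measure E) [IsFiniteMeasure μ] {b : ℝ}
    (hb : 0 < b) :
    ∫ ξ : E, rexp (-b * ‖ξ‖ ^ 2) * ‖charFun μ ξ‖ ^ 2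
      = ∫ p : E × E, (π / b) ^ (Module.finrank ℝ E / 2 : ℝ) * rexp (-‖p.1 - p.2‖ ^ 2 / (4 * b))
          ∂(μ.prod μ) := by
  rw [← Complex.ofReal_inj, ← integral_complex_ofReal, ← integral_complex_ofReal]
  have hb' : 0 < (b : ℂ).re := hb
  have h1 (ξ : E) : ((rexp (-b * ‖ξ‖ ^ 2) * ‖charFun μ ξ‖ ^ 2 : ℝ) : ℂ)
      = ∫ p : E × E, Complex.exp (-b * ‖ξ‖ ^ 2 + Complex.I * ⟪p.1 - p.2, ξ⟫) ∂(μ.prod μ) := by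
    rw [Complex.ofReal_mul, norm_charFun_sq_eq_integral, ← integral_const_mul]
    congr 1 with p
    rw [Complex.exp_add]
    push_cast
    rfl
  simp_rw [h1]
  rw [integral_integral_swap]
  · congr 1 with p
    rw [GaussianFourier.integral_cexp_neg_mul_sq_norm_add hb', Complex.ofReal_mul,
      Complex.ofReal_cpow (by positivity)]
    push_cast
    simp
  · refine ((integrable_exp_neg_mul_norm_sq hb).mul_prod
      (integrable_const (1 : ℝ) (μ := μ.prod μ))).mono' ?_ (.of_forall fun q ↦ ?_)
    · exact (by fun_prop : Continuous _).aestronglyMeasurable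
    · simp only [Function.uncurry, Complex.norm_exp]
      simp [← Complex.ofReal_pow]

lemma lintegral_gaussian_mul_enorm_charFun_sq (μ : Measure E) [IsFiniteMeasure μ] {b : ℝ}
    (hb : 0 < b) :
    ∫⁻ ξ : E, .ofReal (rexp (-b * ‖ξ‖ ^ 2)) * ‖charFun μ ξ‖ₑ ^ 2
      = .ofReal ((π / b) ^ (Module.finrank ℝ E / 2 : ℝ))
        * ∫⁻ y, ∫⁻ z, .ofReal (rexp (-‖y - z‖ ^ 2 / (4 * b))) ∂μ ∂μ := by
  have hi : Integrable (fun ξ : E ↦ rexp (-b * ‖ξ‖ ^ 2) * ‖charFun μ ξ‖ ^ 2) := by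
    refine (integrable_exp_neg_mul_norm_sq hb).mul_bdd (c := μ.real univ ^ 2) ?_ (.of_forall fun ξ ↦ ?_)
    · exact (by fun_prop : Continuous _).aestronglyMeasurable
    · rw [norm_pow, norm_norm]
      gcongr
      exact norm_charFun_le ξ
  have hj : Integrable (fun p : E × E ↦ (π / b) ^ (Module.finrank ℝ E / 2 : ℝ)
      * rexp (-‖p.1 - p.2‖ ^ 2 / (4 * b))) (μ.prod μ) := by
    refine (integrable_const ((π / b) ^ (Module.finrank ℝ E / 2 : ℝ))).mono' ?_
      (.of_forall fun p ↦ ?_)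
    · exact (by fun_prop : Continuous _).aestronglyMeasurable
    · rw [norm_of_nonneg (by positivity)]
      refine mul_le_of_le_one_right (by positivity) (exp_le_one_iff.2 ?_)
      rw [neg_div]
      exact neg_nonpos.2 (by positivity)
  have h := congrArg ENNReal.ofReal (integral_gaussian_mul_norm_charFun_sq μ hb)
  rw [ofReal_integral_eq_lintegral_ofReal hi (.of_forall fun _ ↦ by positivity),
    ofReal_integral_eq_lintegral_ofReal hj (.of_forall fun _ ↦ by positivity)] at h
  simp_rw [ENNReal.ofReal_mul (exp_pos _).le] at h
  simp_rw [ENNReal.ofReal_mul (show 0 ≤ (π / b) ^ (Module.finrank ℝ E / 2 : ℝ) by positivity)] at h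
  rw [lintegral_const_mul _ (by fun_prop), lintegral_prod _ (by fun_prop)] at h
  rw [← h]
  congr 1 with ξ
  rw [ENNReal.ofReal_pow (norm_nonneg _), ofReal_norm]


lemma lintegral_exp_neg_mul_norm_sub_sq {b : ℝ} (hb : 0 < b) (y : E) :
    ∫⁻ z : E, .ofReal (rexp (-b * ‖z - y‖ ^ 2))
      = .ofReal ((π / b) ^ (Module.finrank ℝ E / 2 : ℝ)) := by
  rw [lintegral_sub_right_eq_self (fun z : E ↦ ENNReal.ofReal (rexp (-b * ‖z‖ ^ 2))),
    ← GaussianFourier.integral_rexp_neg_mul_sq_norm hb, ofReal_integral_eq_lintegral_ofReal]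
  · exact integrable_exp_neg_mul_norm_sq hb
  · exact .of_forall fun _ ↦ (exp_pos _).le

/-- Concentration near `ω` of the radial projection of the unit ball to the sphere. -/
lemma lintegral_ball_exp_neg_norm_normalize_sub_sq_le {t : ℝ} (ht : 0 < t) (ht1 : t ≤ 1)
    {ω : E} (hω : ‖ω‖ = 1) :
    ∫⁻ z in Metric.ball (0 : E) 1, .ofReal (rexp (-‖ω - ‖z‖⁻¹ • z‖ ^ 2 / (4 * t)))
      ≤ .ofReal (2 * rexp 1 * (8 * π) ^ (Module.finrank ℝ E / 2 : ℝ)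
          * t ^ ((Module.finrank ℝ E - 1) / 2 : ℝ)) := by
  have hst : 0 < √t := sqrt_pos.2 ht
  have key (z : E) (hz : z ∈ Metric.ball (0 : E) 1) :
      .ofReal (√t) * ENNReal.ofReal (rexp (-‖ω - ‖z‖⁻¹ • z‖ ^ 2 / (4 * t)))
        ≤ ∫⁻ r in Icc (0 : ℝ) 2, .ofReal (rexp 1) *
            .ofReal (rexp (-(8 * t)⁻¹ * ‖z - r • ω‖ ^ 2)) := by
    have hz1 : ‖z‖ < 1 := by simpa using hz
    calc _ = ∫⁻ r in Icc ‖z‖ (‖z‖ + √t),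
          ENNReal.ofReal (rexp (-‖ω - ‖z‖⁻¹ • z‖ ^ 2 / (4 * t))) := by
          rw [setLIntegral_const, Real.volume_Icc, mul_comm]; simp
      _ ≤ ∫⁻ r in Icc ‖z‖ (‖z‖ + √t), .ofReal (rexp 1) *
            .ofReal (rexp (-(8 * t)⁻¹ * ‖z - r • ω‖ ^ 2)) := by
          refine setLIntegral_mono (by fun_prop) fun r hr ↦ ?_
          rw [← ENNReal.ofReal_mul (exp_pos _).le, ← exp_add]
          refine ENNReal.ofReal_le_ofReal (exp_le_exp.2 ?_)
          have h1 : ‖z - r • ω‖ ≤ ‖ω - ‖z‖⁻¹ • z‖ + √t := by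
            have hz0 : ‖z‖ • (‖z‖⁻¹ • z) = z := by
              rcases eq_or_ne z 0 with rfl | h
              · simp
              · rw [smul_smul, mul_inv_cancel₀ (norm_ne_zero_iff.2 h), one_smul]
            calc ‖z - r • ω‖ = ‖-(‖z‖ • (ω - ‖z‖⁻¹ • z)) - (r - ‖z‖) • ω‖ := by
                  rw [smul_sub, hz0, sub_smul]; congr 1; abel
              _ ≤ ‖-(‖z‖ • (ω - ‖z‖⁻¹ • z))‖ + ‖(r - ‖z‖) • ω‖ := norm_sub_le _ _
              _ ≤ _ := by
                  rw [norm_neg, norm_smul, norm_smul, hω, norm_norm, mul_one, norm_eq_abs,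
                    abs_of_nonneg (by linarith [hr.1])]
                  gcongr
                  · exact mul_le_of_le_one_left (norm_nonneg _) hz1.le
                  · linarith [hr.2]
          have h2 : ‖z - r • ω‖ ^ 2 ≤ 2 * ‖ω - ‖z‖⁻¹ • z‖ ^ 2 + 2 * t := by
            nlinarith [sq_sqrt ht.le, sq_nonneg (‖ω - ‖z‖⁻¹ • z‖ - √t), norm_nonneg (z - r • ω)]
          have h3 : 1 + -(8 * t)⁻¹ * ‖z - r • ω‖ ^ 2 - -‖ω - ‖z‖⁻¹ • z‖ ^ 2 / (4 * t)
              = (8 * t + 2 * ‖ω - ‖z‖⁻¹ • z‖ ^ 2 - ‖z - r • ω‖ ^ 2) / (8 * t) := by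
            field_simp
            ring
          rw [← sub_nonneg, h3]
          exact div_nonneg (by linarith) (by linarith)
      _ ≤ _ := by
          refine lintegral_mono_set (Icc_subset_Icc (norm_nonneg _) ?_)
          have : √t ≤ 1 := sqrt_le_one.2 ht1
          linarith
  have h := calc
    .ofReal (√t) * ∫⁻ z in Metric.ball (0 : E) 1,
        ENNReal.ofReal (rexp (-‖ω - ‖z‖⁻¹ • z‖ ^ 2 / (4 * t)))
      = ∫⁻ z in Metric.ball (0 : E) 1,
        .ofReal (√t) * ENNReal.ofReal (rexp (-‖ω - ‖z‖⁻¹ • z‖ ^ 2 / (4 * t))) := by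
          rw [lintegral_const_mul _ (by fun_prop)]
    _ ≤ ∫⁻ z in Metric.ball (0 : E) 1, ∫⁻ r in Icc (0 : ℝ) 2, .ofReal (rexp 1) *
            .ofReal (rexp (-(8 * t)⁻¹ * ‖z - r • ω‖ ^ 2)) :=
          setLIntegral_mono' measurableSet_ball key
    _ ≤ ∫⁻ z : E, ∫⁻ r in Icc (0 : ℝ) 2, .ofReal (rexp 1) *
            .ofReal (rexp (-(8 * t)⁻¹ * ‖z - r • ω‖ ^ 2)) := setLIntegral_le_lintegral _ _
    _ = ∫⁻ r in Icc (0 : ℝ) 2, ∫⁻ z : E, .ofReal (rexp 1) *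
            .ofReal (rexp (-(8 * t)⁻¹ * ‖z - r • ω‖ ^ 2)) :=
          lintegral_lintegral_swap (by fun_prop)
    _ = ∫⁻ r in Icc (0 : ℝ) 2, .ofReal (rexp 1) *
            .ofReal ((π / (8 * t)⁻¹) ^ (Module.finrank ℝ E / 2 : ℝ)) := by
          congr 1 with r
          rw [lintegral_const_mul _ (by fun_prop),
            lintegral_exp_neg_mul_norm_sub_sq (by positivity)]
    _ = .ofReal (√t) * .ofReal (2 * rexp 1 * (8 * π) ^ (Module.finrank ℝ E / 2 : ℝ)
          * t ^ ((Module.finrank ℝ E - 1) / 2 : ℝ)) := by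
          rw [setLIntegral_const, Real.volume_Icc, ← ENNReal.ofReal_mul (by positivity),
            ← ENNReal.ofReal_mul (by positivity), ← ENNReal.ofReal_mul (by positivity)]
          congr 1
          have e1 : π / (8 * t)⁻¹ = (8 * π) * t := by field_simp
          have e2 : t ^ (Module.finrank ℝ E / 2 : ℝ)
              = √t * t ^ ((Module.finrank ℝ E - 1) / 2 : ℝ) := by
            rw [sqrt_eq_rpow, ← rpow_add ht]
            congr 1
            ring
          rw [e1, mul_rpow (by positivity) ht.le, e2]
          ring
  exact (ENNReal.mul_le_mul_iff_right (by simpa using hst) ENNReal.ofReal_ne_top).1 h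

/-- A finite measure satisfying a Frostman-type bound of codimension one has finite
`Ḣ^{-s}` norm. -/
lemma lintegral_rpow_mul_enorm_charFun_sq_lt_top (μ : Measure E) [IsFiniteMeasure μ] {s C : ℝ}
    (hs1 : 1 / 2 < s) (hs2 : s < Module.finrank ℝ E / 2) (_hC : 0 ≤ C)
    (h : ∀ᵐ y ∂μ, ∀ t : ℝ, 0 < t → t ≤ 1 →
      ∫⁻ z, .ofReal (rexp (-‖y - z‖ ^ 2 / (4 * t))) ∂μ
        ≤ .ofReal (C * t ^ ((Module.finrank ℝ E - 1) / 2 : ℝ))) :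
    ∫⁻ ξ : E, .ofReal (‖ξ‖ ^ (-(2 * s))) * ‖charFun μ ξ‖ₑ ^ 2 < ∞ := by
  set d : ℝ := (Module.finrank ℝ E : ℝ) with hd
  have hs : 0 < s := by linarith
  have hm : Measurable fun ξ : E ↦ ‖charFun μ ξ‖ₑ ^ 2 := by fun_prop
  have hpt (ξ : E) : .ofReal (Gamma s) * ENNReal.ofReal (‖ξ‖ ^ (-(2 * s)))
      ≤ ∫⁻ t in Ioi (0 : ℝ), .ofReal (t ^ (s - 1)) * .ofReal (rexp (-t * ‖ξ‖ ^ 2)) := by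
    rcases eq_or_ne ξ 0 with rfl | hξ
    · rw [norm_zero, zero_rpow (by linarith)]
      simp
    have hr : 0 < ‖ξ‖ ^ 2 := by positivity
    have hG := integral_rpow_mul_exp_neg_mul_Ioi hs hr
    have hint : IntegrableOn (fun t : ℝ ↦ t ^ (s - 1) * rexp (-(‖ξ‖ ^ 2 * t))) (Ioi 0) :=
      .of_integral_ne_zero (by
        rw [hG]
        exact (mul_pos (by positivity) (Gamma_pos_of_pos hs)).ne')
    have hG' := congrArg ENNReal.ofReal hG
    rw [ofReal_integral_eq_lintegral_ofReal hint
      ((ae_restrict_iff' measurableSet_Ioi).2 (.of_forall fun t (ht : 0 < t) ↦ by positivity))]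
      at hG'
    rw [← ENNReal.ofReal_mul (Gamma_pos_of_pos hs).le]
    have e : Gamma s * ‖ξ‖ ^ (-(2 * s)) = (1 / ‖ξ‖ ^ 2) ^ s * Gamma s := by
      rw [one_div, inv_rpow hr.le, ← rpow_natCast, ← rpow_mul (norm_nonneg _), rpow_neg
        (norm_nonneg _), mul_comm]
      norm_num
    rw [e, ← hG']
    refine (setLIntegral_congr_fun measurableSet_Ioi fun t (ht : 0 < t) ↦ ?_).le
    rw [← ENNReal.ofReal_mul (by positivity)]
    ring_nf
  set A : ℝ → ℝ≥0∞ := fun t ↦ ∫⁻ y, ∫⁻ z, .ofReal (rexp (-‖y - z‖ ^ 2 / (4 * t))) ∂μ ∂μ with hA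
  have hA1 (t : ℝ) (ht : 0 < t) (ht1 : t ≤ 1) :
      A t ≤ .ofReal (C * t ^ ((d - 1) / 2)) * μ univ := by
    rw [← lintegral_const]
    exact lintegral_mono_ae (h.mono fun y hy ↦ hy t ht ht1)
  have hA2 (t : ℝ) (ht : 0 < t) : A t ≤ μ univ * μ univ := by
    rw [← lintegral_const]
    refine lintegral_mono fun y ↦ ?_
    calc _ ≤ ∫⁻ _, 1 ∂μ := by
          refine lintegral_mono fun z ↦ ENNReal.ofReal_le_one.2 (exp_le_one_iff.2 ?_)
          rw [neg_div]
          exact neg_nonpos.2 (by positivity)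
      _ = _ := by simp
  have hbound := calc
    .ofReal (Gamma s) * ∫⁻ ξ : E, .ofReal (‖ξ‖ ^ (-(2 * s))) * ‖charFun μ ξ‖ₑ ^ 2
      = ∫⁻ ξ : E, .ofReal (Gamma s) * .ofReal (‖ξ‖ ^ (-(2 * s))) * ‖charFun μ ξ‖ₑ ^ 2 := by
        simp_rw [mul_assoc]
        rw [lintegral_const_mul' _ _ ENNReal.ofReal_ne_top]
    _ ≤ ∫⁻ ξ : E, ∫⁻ t in Ioi (0 : ℝ), .ofReal (t ^ (s - 1)) *
          (.ofReal (rexp (-t * ‖ξ‖ ^ 2)) * ‖charFun μ ξ‖ₑ ^ 2) := by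
        refine lintegral_mono fun ξ ↦ (mul_le_mul_left (hpt ξ) _).trans ?_
        rw [← lintegral_mul_const _ (by fun_prop)]
        simp_rw [mul_assoc]
        rfl
    _ = ∫⁻ t in Ioi (0 : ℝ), ∫⁻ ξ : E, .ofReal (t ^ (s - 1)) *
          (.ofReal (rexp (-t * ‖ξ‖ ^ 2)) * ‖charFun μ ξ‖ₑ ^ 2) :=
        lintegral_lintegral_swap (by fun_prop)
    _ = ∫⁻ t in Ioi (0 : ℝ), .ofReal (t ^ (s - 1)) * (.ofReal ((π / t) ^ (d / 2)) * A t) := by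
        refine setLIntegral_congr_fun measurableSet_Ioi fun t (ht : 0 < t) ↦ ?_
        rw [lintegral_const_mul _ (by fun_prop), lintegral_gaussian_mul_enorm_charFun_sq μ ht]
    _ ≤ (∫⁻ t in Ioc (0 : ℝ) 1, .ofReal (t ^ (s - 1)) * (.ofReal ((π / t) ^ (d / 2)) * A t))
        + ∫⁻ t in Ioi (1 : ℝ), .ofReal (t ^ (s - 1)) * (.ofReal ((π / t) ^ (d / 2)) * A t) := by
        rw [← Ioc_union_Ioi_eq_Ioi (zero_le_one' ℝ)]
        exact lintegral_union_le _ _ _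
    _ ≤ (∫⁻ t in Ioc (0 : ℝ) 1, .ofReal (π ^ (d / 2) * C * t ^ (s - 3 / 2)) * μ univ)
        + ∫⁻ t in Ioi (1 : ℝ), .ofReal (π ^ (d / 2) * t ^ (s - 1 - d / 2))
          * (μ univ * μ univ) := by
        refine add_le_add (setLIntegral_mono' measurableSet_Ioc fun t ht ↦ ?_)
          (setLIntegral_mono' measurableSet_Ioi fun t (ht : 1 < t) ↦ ?_)
        · have ht0 : 0 < t := ht.1
          grw [hA1 t ht0 ht.2]
          rw [← mul_assoc, ← mul_assoc, ← ENNReal.ofReal_mul (by positivity),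
            ← ENNReal.ofReal_mul (by positivity)]
          refine (congrArg (fun a ↦ ENNReal.ofReal a * μ univ) ?_).le
          rw [div_rpow pi_pos.le ht0.le, div_eq_mul_inv, ← rpow_neg ht0.le]
          calc _ = π ^ (d / 2) * C * (t ^ (s - 1) * t ^ (-(d / 2)) * t ^ ((d - 1) / 2)) := by ring
            _ = _ := by
              rw [← rpow_add ht0, ← rpow_add ht0]
              ring_nf
        · have ht0 : 0 < t := by linarith
          grw [hA2 t ht0]
          rw [← mul_assoc, ← ENNReal.ofReal_mul (by positivity)]
          refine (congrArg (fun a ↦ ENNReal.ofReal a * (μ univ * μ univ)) ?_).le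
          rw [div_rpow pi_pos.le ht0.le, div_eq_mul_inv, ← rpow_neg ht0.le]
          calc _ = π ^ (d / 2) * (t ^ (s - 1) * t ^ (-(d / 2))) := by ring
            _ = _ := by
              rw [← rpow_add ht0]
              ring_nf
    _ < ∞ := by
        have i1 : IntegrableOn (fun t : ℝ ↦ π ^ (d / 2) * C * t ^ (s - 3 / 2)) (Ioc 0 1) :=
          ((intervalIntegrable_iff_integrableOn_Ioc_of_le zero_le_one).1
            (intervalIntegral.intervalIntegrable_rpow' (by linarith))).const_mul _
        have i2 : IntegrableOn (fun t : ℝ ↦ π ^ (d / 2) * t ^ (s - 1 - d / 2)) (Ioi 1) :=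
          (integrableOn_Ioi_rpow_of_lt (by linarith) zero_lt_one).const_mul _
        rw [lintegral_mul_const _ (by fun_prop), lintegral_mul_const _ (by fun_prop)]
        exact ENNReal.add_lt_top.2 ⟨ENNReal.mul_lt_top i1.lintegral_lt_top (measure_lt_top _ _),
          ENNReal.mul_lt_top i2.lintegral_lt_top
            (ENNReal.mul_lt_top (measure_lt_top _ _) (measure_lt_top _ _))⟩
  exact ENNReal.lt_top_of_mul_ne_top_right hbound.ne (by simpa using Gamma_pos_of_pos hs)

/-- Duality between `Ḣ^s` and `Ḣ^{-s}`. -/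
lemma enorm_integral_comp_smul_le [Nontrivial E] (μ : Measure E) [IsFiniteMeasure μ]
    {s R : ℝ} (hR : 0 < R) (f : SchwartzMap E ℂ) :
    ‖∫ y, f (R • y) ∂μ‖ₑ
      ≤ (∫⁻ ξ : E, .ofReal (‖ξ‖ ^ (2 * s)) * ‖𝓕 (⇑f) ξ‖ₑ ^ 2) ^ (1 / 2 : ℝ)
        * (.ofReal ((2 * π * R) ^ (2 * s - Module.finrank ℝ E)) *
          ∫⁻ ξ : E, .ofReal (‖ξ‖ ^ (-(2 * s))) * ‖charFun μ ξ‖ₑ ^ 2) ^ (1 / 2 : ℝ) := by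
  set g : SchwartzMap E ℂ := 𝓕 f with hg
  have hgf : 𝓕 (⇑f) = ⇑g := rfl
  rw [hgf]
  have hR2 : 0 < 2 * π * R := by positivity
  have hpt (y : E) : f (R • y) = ∫ ξ : E, Complex.exp (⟪y, (2 * π * R) • ξ⟫ * Complex.I) * g ξ := by
    have h1 : 𝓕⁻ (⇑g) (R • y) = f (R • y) := by
      rw [← SchwartzMap.fourierInv_coe, hg, FourierTransform.fourierInv_fourier_eq]
    rw [← h1, Real.fourierInv_eq']
    congr 1 with ξ
    rw [smul_eq_mul, real_inner_smul_right, real_inner_smul_right, real_inner_comm ξ y]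
    push_cast
    ring_nf
  have hswap : ∫ y, f (R • y) ∂μ = ∫ ξ : E, charFun μ ((2 * π * R) • ξ) * g ξ := by
    simp_rw [hpt, charFun_apply, ← integral_mul_const]
    refine integral_integral_swap ?_
    refine ((integrable_const (1 : ℝ) (μ := μ)).mul_prod g.integrable.norm).mono' ?_
      (.of_forall fun q ↦ ?_)
    · exact (by fun_prop : Continuous _).aestronglyMeasurable
    · simp [Function.uncurry, Complex.norm_exp]
  have hscale : ∫⁻ ξ : E, .ofReal (‖ξ‖ ^ (-(2 * s))) * ‖charFun μ ((2 * π * R) • ξ)‖ₑ ^ 2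
      = .ofReal ((2 * π * R) ^ (2 * s - Module.finrank ℝ E)) *
          ∫⁻ ξ : E, .ofReal (‖ξ‖ ^ (-(2 * s))) * ‖charFun μ ξ‖ₑ ^ 2 := by
    have hF : Measurable fun ξ : E ↦ .ofReal (‖ξ‖ ^ (-(2 * s))) * ‖charFun μ ξ‖ₑ ^ 2 := by fun_prop
    have h1 := lintegral_map (μ := (volume : Measure E)) hF
      (measurable_const_smul (2 * π * R))
    rw [Measure.map_addHaar_smul _ hR2.ne', lintegral_smul_measure, smul_eq_mul] at h1
    have h2 (ξ : E) : ENNReal.ofReal (‖ξ‖ ^ (-(2 * s))) * ‖charFun μ ((2 * π * R) • ξ)‖ₑ ^ 2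
        = .ofReal ((2 * π * R) ^ (2 * s)) * (.ofReal (‖(2 * π * R) • ξ‖ ^ (-(2 * s)))
          * ‖charFun μ ((2 * π * R) • ξ)‖ₑ ^ 2) := by
      rw [← mul_assoc, ← ENNReal.ofReal_mul (by positivity), norm_smul, norm_of_nonneg hR2.le,
        mul_rpow hR2.le (norm_nonneg _), ← mul_assoc, ← rpow_add hR2]
      simp
    simp_rw [h2]
    rw [lintegral_const_mul _ (by fun_prop), ← h1, ← mul_assoc,
      ← ENNReal.ofReal_mul (by positivity), abs_of_pos (by positivity), sub_eq_add_neg,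
      rpow_add hR2, rpow_neg hR2.le, rpow_natCast]
  calc _ = ‖∫ ξ : E, charFun μ ((2 * π * R) • ξ) * g ξ‖ₑ := by rw [hswap]
    _ ≤ ∫⁻ ξ : E, ‖charFun μ ((2 * π * R) • ξ) * g ξ‖ₑ := enorm_integral_le_lintegral_enorm _
    _ = ∫⁻ ξ : E, (.ofReal (‖ξ‖ ^ s) * ‖g ξ‖ₑ)
          * (.ofReal (‖ξ‖ ^ (-s)) * ‖charFun μ ((2 * π * R) • ξ)‖ₑ) := by
        refine lintegral_congr_ae ?_
        filter_upwards [compl_mem_ae_iff.2 (measure_singleton (0 : E))] with ξ hξ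
        have hξ0 : 0 < ‖ξ‖ := norm_pos_iff.2 hξ
        have h4 : ENNReal.ofReal (‖ξ‖ ^ s) * .ofReal (‖ξ‖ ^ (-s)) = 1 := by
          rw [← ENNReal.ofReal_mul (by positivity), ← rpow_add hξ0]
          simp
        rw [mul_mul_mul_comm, h4, one_mul, enorm_mul, mul_comm]
    _ ≤ (∫⁻ ξ : E, (.ofReal (‖ξ‖ ^ s) * ‖g ξ‖ₑ) ^ (2 : ℝ)) ^ (1 / 2 : ℝ)
        * (∫⁻ ξ : E, (.ofReal (‖ξ‖ ^ (-s)) * ‖charFun μ ((2 * π * R) • ξ)‖ₑ) ^ (2 : ℝ))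
          ^ (1 / 2 : ℝ) :=
        ENNReal.lintegral_mul_le_Lp_mul_Lq _ HolderConjugate.two_two (by fun_prop) (by fun_prop)
    _ = _ := by
        rw [← hscale]
        have h3 (a : ℝ) (ξ : E) (c : ℝ≥0∞) : (ENNReal.ofReal (‖ξ‖ ^ a) * c) ^ (2 : ℝ)
            = .ofReal (‖ξ‖ ^ (2 * a)) * c ^ 2 := by
          rw [ENNReal.mul_rpow_of_nonneg _ _ zero_le_two,
            ENNReal.ofReal_rpow_of_nonneg (by positivity) zero_le_two,
            ← rpow_mul (norm_nonneg _), mul_comm a]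
          norm_cast
        simp_rw [h3]
        ring_nf

lemma SchwartzMap.integrable_rpow_mul_norm_sq (g : SchwartzMap E ℂ) {a : ℝ} (ha : 0 ≤ a) :
    Integrable fun ξ : E ↦ ‖ξ‖ ^ a * ‖g ξ‖ ^ 2 := by
  obtain ⟨k, hk⟩ := exists_nat_ge a
  have hM (ξ : E) : ‖g ξ‖ ≤ ‖g.toBoundedContinuousFunction‖ :=
    g.toBoundedContinuousFunction.norm_coe_le_norm ξ
  have hi := ((g.integrable.norm.add (g.integrable_pow_mul volume k)).mul_const
    ‖g.toBoundedContinuousFunction‖)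
  refine hi.mono' ?_ (.of_forall fun ξ ↦ ?_)
  · exact ((continuous_norm.rpow_const fun _ ↦ .inr ha).mul (by fun_prop)).aestronglyMeasurable
  · rw [norm_of_nonneg (by positivity), pow_two, ← mul_assoc]
    refine mul_le_mul ?_ (hM ξ) (norm_nonneg _) (by simp; positivity)
    have : ‖ξ‖ ^ a ≤ 1 + ‖ξ‖ ^ k := by
      rcases le_total ‖ξ‖ 1 with h | h
      · exact (rpow_le_one (norm_nonneg _) h ha).trans (by simp)
      · exact (rpow_le_rpow_of_exponent_le h hk).trans (by simp)
    simp only [Pi.add_apply]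
    nlinarith [norm_nonneg (g ξ)]

/-- The image of Lebesgue measure on the unit ball under the radial projection to the sphere has
finite `Ḣ^{-s}` norm. -/
lemma lintegral_rpow_mul_enorm_charFun_map_normalize_sq_lt_top [Nontrivial E] {s : ℝ}
    (hs1 : 1 / 2 < s) (hs2 : s < Module.finrank ℝ E / 2) :
    ∫⁻ ξ : E, .ofReal (‖ξ‖ ^ (-(2 * s))) * ‖charFun
      ((volume.restrict (Metric.ball (0 : E) 1)).map fun z ↦ ‖z‖⁻¹ • z) ξ‖ₑ ^ 2 < ∞ := by
  have hu : Measurable fun z : E ↦ ‖z‖⁻¹ • z := by fun_prop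
  have : IsFiniteMeasure (volume.restrict (Metric.ball (0 : E) 1)) :=
    isFiniteMeasure_restrict.2 measure_ball_lt_top.ne
  refine lintegral_rpow_mul_enorm_charFun_sq_lt_top _ hs1 hs2
    (C := 2 * rexp 1 * (8 * π) ^ (Module.finrank ℝ E / 2 : ℝ)) (by positivity) ?_
  have hunit : ∀ᵐ y ∂((volume.restrict (Metric.ball (0 : E) 1)).map fun z ↦ ‖z‖⁻¹ • z),
      ‖y‖ = 1 := by
    rw [ae_map_iff hu.aemeasurable (measurableSet_eq_fun (by fun_prop) (by fun_prop))]
    refine ae_restrict_of_ae ?_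
    filter_upwards [compl_mem_ae_iff.2 (measure_singleton (0 : E))] with z hz
    exact norm_smul_inv_norm (𝕜 := ℝ) hz
  filter_upwards [hunit] with y hy t ht ht1
  rw [lintegral_map (by fun_prop) hu]
  exact lintegral_ball_exp_neg_norm_normalize_sub_sq_le ht ht1 hy

/-- A radial function is constant along the radial projection to the sphere. -/
lemma integral_map_normalize_of_radial [Nontrivial E] {f : E → ℂ} (hf : Continuous f)
    (hrad : ∀ x y : E, ‖x‖ = ‖y‖ → f x = f y) (x : E) :
    ∫ y, f (‖x‖ • y) ∂((volume.restrict (Metric.ball (0 : E) 1)).map fun z ↦ ‖z‖⁻¹ • z)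
      = volume.real (Metric.ball (0 : E) 1) * f x := by
  rw [integral_map (by fun_prop) (by fun_prop : Continuous _).aestronglyMeasurable]
  have : ∀ᵐ z ∂(volume.restrict (Metric.ball (0 : E) 1)), f (‖x‖ • (‖z‖⁻¹ • z)) = f x := by
    refine ae_restrict_of_ae ?_
    filter_upwards [compl_mem_ae_iff.2 (measure_singleton (0 : E))] with z hz
    refine hrad _ _ ?_
    rw [norm_smul, norm_norm, show ‖‖z‖⁻¹ • z‖ = 1 from norm_smul_inv_norm (𝕜 := ℝ) hz, mul_one]
  rw [integral_congr_ae this]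
  simp

/-- Radial Sobolev embedding on a finite-dimensional inner product space. -/
theorem exists_norm_le_of_radial [Nontrivial E] {s : ℝ} (hs1 : 1 / 2 < s)
    (hs2 : s < Module.finrank ℝ E / 2) :
    ∃ C : ℝ, 0 < C ∧ ∀ f : SchwartzMap E ℂ, (∀ x y : E, ‖x‖ = ‖y‖ → f x = f y) →
      ∀ x : E, x ≠ 0 →
        ‖f x‖ ≤ C * ‖x‖ ^ (s - Module.finrank ℝ E / 2)
          * √(∫ ξ : E, ‖ξ‖ ^ (2 * s) * ‖𝓕 (⇑f) ξ‖ ^ 2) := by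
  set μ : Measure E := (volume.restrict (Metric.ball (0 : E) 1)).map fun z ↦ ‖z‖⁻¹ • z with hμ
  have : IsFiniteMeasure (volume.restrict (Metric.ball (0 : E) 1)) :=
    isFiniteMeasure_restrict.2 measure_ball_lt_top.ne
  have : IsFiniteMeasure μ := by rw [hμ]; infer_instance
  set d : ℝ := (Module.finrank ℝ E : ℝ) with hd
  have hK := lintegral_rpow_mul_enorm_charFun_map_normalize_sq_lt_top (E := E) hs1 hs2
  rw [← hμ] at hK
  set K := ∫⁻ ξ : E, .ofReal (‖ξ‖ ^ (-(2 * s))) * ‖charFun μ ξ‖ₑ ^ 2 with hKdef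
  set V : ℝ := volume.real (Metric.ball (0 : E) 1) with hVdef
  have hV : 0 < V := ENNReal.toReal_pos (Metric.measure_ball_pos _ _ one_pos).ne'
    measure_ball_lt_top.ne
  set c : ℝ := (2 * π) ^ (s - d / 2) * √K.toReal / V with hc
  have hc0 : 0 ≤ c := by positivity
  refine ⟨c + 1, by positivity, fun f hrad x hx ↦ ?_⟩
  have hx0 : 0 < ‖x‖ := norm_pos_iff.2 hx
  set I : ℝ := ∫ ξ : E, ‖ξ‖ ^ (2 * s) * ‖𝓕 (⇑f) ξ‖ ^ 2 with hI
  have hI0 : 0 ≤ I := integral_nonneg fun ξ ↦ by positivity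
  have hIe : ∫⁻ ξ : E, .ofReal (‖ξ‖ ^ (2 * s)) * ‖𝓕 (⇑f) ξ‖ₑ ^ 2 = .ofReal I := by
    have hint : Integrable fun ξ : E ↦ ‖ξ‖ ^ (2 * s) * ‖𝓕 (⇑f) ξ‖ ^ 2 :=
      (𝓕 f : SchwartzMap E ℂ).integrable_rpow_mul_norm_sq (by linarith)
    rw [hI, ofReal_integral_eq_lintegral_ofReal hint (.of_forall fun ξ ↦ by positivity)]
    congr 1 with ξ
    rw [ENNReal.ofReal_mul (by positivity), ENNReal.ofReal_pow (norm_nonneg _), ofReal_norm]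
  have hdual := enorm_integral_comp_smul_le μ (s := s) hx0 f
  rw [integral_map_normalize_of_radial f.continuous hrad x, hIe, ← hd, ← hKdef, ← hVdef,
    ← ENNReal.ofReal_toReal hK.ne, ← ENNReal.ofReal_mul (by positivity),
    ENNReal.ofReal_rpow_of_nonneg hI0 (by norm_num),
    ENNReal.ofReal_rpow_of_nonneg (by positivity) (by norm_num),
    ← ENNReal.ofReal_mul (by positivity), ← ofReal_norm,
    ENNReal.ofReal_le_ofReal_iff (by positivity), norm_mul, Complex.norm_real,
    norm_of_nonneg hV.le, ← sqrt_eq_rpow, ← sqrt_eq_rpow, sqrt_mul (by positivity)] at hdual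
  have hsq : √((2 * π * ‖x‖) ^ (2 * s - d)) = (2 * π) ^ (s - d / 2) * ‖x‖ ^ (s - d / 2) := by
    rw [sqrt_eq_rpow, ← rpow_mul (by positivity), ← mul_rpow (by positivity) hx0.le]
    ring_nf
  rw [hsq] at hdual
  calc ‖f x‖ ≤ √I * ((2 * π) ^ (s - d / 2) * ‖x‖ ^ (s - d / 2) * √K.toReal) / V := by
        rwa [le_div_iff₀ hV, mul_comm]
    _ = c * ‖x‖ ^ (s - d / 2) * √I := by rw [hc]; ring
    _ ≤ (c + 1) * ‖x‖ ^ (s - d / 2) * √I := by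
        gcongr
        linarith

end

/-- Radial Sobolev embedding via the Fourier transform: for `1/2 < s < n/2` and radial
Schwartz `f`, `|f(x)| ≤ C‖x‖^{s−n/2}‖f‖_{Ḣ^s}` for all `x ≠ 0`. -/
theorem stmt17 (n : ℕ) (hn : 2 ≤ n) (s : ℝ) (hs1 : 1 / 2 < s) (hs2 : s < (n : ℝ) / 2) :
    ∃ C : ℝ, 0 < C ∧ ∀ f : SchwartzMap (EuclideanSpace ℝ (Fin n)) ℂ,
      (∀ x y : EuclideanSpace ℝ (Fin n), ‖x‖ = ‖y‖ → f x = f y) →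
      ∀ x : EuclideanSpace ℝ (Fin n), x ≠ 0 →
        ‖f x‖ ≤ C * ‖x‖ ^ (s - (n : ℝ) / 2)
          * Real.sqrt (∫ ξ : EuclideanSpace ℝ (Fin n),
              ‖ξ‖ ^ (2 * s) * ‖𝓕 (⇑f) ξ‖ ^ 2) := by
  have : Nontrivial (EuclideanSpace ℝ (Fin n)) :=
    Module.nontrivial_of_finrank_pos (R := ℝ) (by rw [finrank_euclideanSpace_fin]; omega)
  simpa only [finrank_euclideanSpace_fin] using
    exists_norm_le_of_radial (E := EuclideanSpace ℝ (Fin n)) hs1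
      (by rwa [finrank_euclideanSpace_fin])
end
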